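/- Let Σ ⊆ ℝ^N (N ≥ 2) be an open convex cone with vertex at 0 and let B = {x : H₀(x) < 1} be the unit Wulff ball of H centered at 0. Then for every Lebesgue-measurable set E ⊆ ℝ^N with |Σ∩E| < ∞ (where |·| denotes Lebesgue measure), the anisotropic isoperimetric inequality in the cone holds: P_H(E;Σ) · |Σ∩B|^{(N−1)/N} ≥ P_H(B;Σ) · |Σ∩E|^{(N−1)/N}. -/

import Mathlib

open MeasureTheory Set Metric
open scoped ENNReal NNReal RealInnerProductSpace Topology Classical

noncomputable section

/-- Divergence of a vector field on `ℝ^N`, computed coordinatewise. -/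
def vdiv {N : ℕ} (σ : EuclideanSpace ℝ (Fin N) → EuclideanSpace ℝ (Fin N))
    (x : EuclideanSpace ℝ (Fin N)) : ℝ :=
  ∑ i, fderiv ℝ σ x (EuclideanSpace.single i 1) i

/-- The dual norm `H₀(x) = sup_{ξ ≠ 0} ⟨x, ξ⟩ / H(ξ)`. -/
def dualNorm {N : ℕ} (H : EuclideanSpace ℝ (Fin N) → ℝ) (x : EuclideanSpace ℝ (Fin N)) : ℝ :=
  sSup ((fun ξ => ⟪x, ξ⟫ / H ξ) '' {ξ : EuclideanSpace ℝ (Fin N) | ξ ≠ 0})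

/-- `H` is a norm on `ℝ^N`: convex, positive away from `0`, absolutely homogeneous. -/
structure IsAnisoNorm {N : ℕ} (H : EuclideanSpace ℝ (Fin N) → ℝ) : Prop where
  conv : ConvexOn ℝ Set.univ H
  pos : ∀ ξ, ξ ≠ 0 → 0 < H ξ
  hom : ∀ (t : ℝ) (ξ : EuclideanSpace ℝ (Fin N)), H (t • ξ) = |t| * H ξ

/-- `H` is `C²` away from the origin and uniformly elliptic: the Hessian of
`ξ ↦ ½ H(ξ)²` is positive definite at every `ξ ≠ 0`. -/
def UniformlyElliptic {N : ℕ} (H : EuclideanSpace ℝ (Fin N) → ℝ) : Prop :=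
  ContDiffOn ℝ 2 H {(0 : EuclideanSpace ℝ (Fin N))}ᶜ ∧
  ∀ ξ : EuclideanSpace ℝ (Fin N), ξ ≠ 0 → ∀ v : EuclideanSpace ℝ (Fin N), v ≠ 0 →
    0 < ⟪fderiv ℝ (gradient (fun z => H z ^ 2 / 2)) ξ v, v⟫

/-- The anisotropic vector field `H(∇u)^{p-1} ∇H(∇u)`, understood to be `0`
at points where `∇u = 0`. -/
def aField {N : ℕ} (H : EuclideanSpace ℝ (Fin N) → ℝ) (p : ℝ)
    (u : EuclideanSpace ℝ (Fin N) → ℝ) (x : EuclideanSpace ℝ (Fin N)) :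
    EuclideanSpace ℝ (Fin N) :=
  if gradient u x = 0 then 0 else H (gradient u x) ^ (p - 1) • gradient H (gradient u x)

/-- Weighted anisotropic perimeter of `E` relative to `S`:
`sup { ∫_E div σ : σ ∈ C¹_c(S; ℝ^N), ρ(σ(x)) ≤ w(x) for all x }`, valued in `[0,∞]`. -/
def periW {N : ℕ} (ρ w : EuclideanSpace ℝ (Fin N) → ℝ)
    (E S : Set (EuclideanSpace ℝ (Fin N))) : ℝ≥0∞ :=
  ⨆ σ ∈ {σ : EuclideanSpace ℝ (Fin N) → EuclideanSpace ℝ (Fin N) |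
      ContDiff ℝ 1 σ ∧ HasCompactSupport σ ∧ tsupport σ ⊆ S ∧ ∀ x, ρ (σ x) ≤ w x},
    ENNReal.ofReal (∫ x in E, vdiv σ x)

/-- Open convex cone with vertex at the origin (the case `S = ℝ^N` is allowed). -/
def IsOpenConvexCone {N : ℕ} (S : Set (EuclideanSpace ℝ (Fin N))) : Prop :=
  IsOpen S ∧ Convex ℝ S ∧ ∀ x ∈ S, ∀ t : ℝ, 0 < t → t • x ∈ S

/-- The lineality space of `S`: directions along which `S` is translation invariant.
For a convex cone `Σ = ℝ^k × Σ̃` with `Σ̃` containing no lines this is `ℝ^k × {0}`. -/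
def lineality {N : ℕ} (S : Set (EuclideanSpace ℝ (Fin N))) :
    Set (EuclideanSpace ℝ (Fin N)) :=
  {v | ∀ x ∈ S, ∀ t : ℝ, x + t • v ∈ S}

/-- One-dimensional Brunn–Minkowski inequality. -/
theorem Real.volume_add_volume_le {A B C : Set ℝ} (hA : MeasurableSet A) (hB : MeasurableSet B)
    (hA0 : A.Nonempty) (hB0 : B.Nonempty) (hC : ∀ a ∈ A, ∀ b ∈ B, a + b ∈ C) :
    volume A + volume B ≤ volume C := by
  have compact_case : ∀ K L : Set ℝ, IsCompact K → IsCompact L → K.Nonempty → L.Nonempty →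
      K ⊆ A → L ⊆ B → volume K + volume L ≤ volume C := by
    intro K L hK hL hK0 hL0 hKA hLB
    have hs := hK.sSup_mem hK0
    have hi := hL.sInf_mem hL0
    set a := sSup K
    set b := sInf L
    have hle : ∀ x ∈ K, x ≤ a := fun x hx => le_csSup hK.bddAbove hx
    have hge : ∀ y ∈ L, b ≤ y := fun y hy => csInf_le hL.bddBelow hy
    have hd : AEDisjoint volume ((fun x => x + b) '' K) ((fun y => a + y) '' L) := by
      refine measure_mono_null (t := {a + b}) ?_ (by simp)
      rintro _ ⟨⟨x, hx, rfl⟩, ⟨y, hy, hxy⟩⟩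
      have := hle x hx
      have := hge y hy
      simp only at hxy ⊢
      rw [mem_singleton_iff]
      linarith
    have hLm : MeasurableSet ((fun y => a + y) '' L) :=
      (hL.image (by fun_prop)).measurableSet
    calc volume K + volume L
        = volume ((fun x => x + b) '' K) + volume ((fun y => a + y) '' L) := by
          rw [image_add_right, image_add_left, measure_preimage_add_right,
            measure_preimage_add]
      _ = volume ((fun x => x + b) '' K ∪ (fun y => a + y) '' L) :=
          (measure_union₀ hLm.nullMeasurableSet hd).symm
      _ ≤ volume C := by
          refine measure_mono (union_subset ?_ ?_)
          · rintro _ ⟨x, hx, rfl⟩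
            exact hC x (hKA hx) b (hLB hi)
          · rintro _ ⟨y, hy, rfl⟩
            exact hC a (hKA hs) y (hLB hy)
  obtain ⟨a, ha⟩ := hA0
  obtain ⟨b, hb⟩ := hB0
  rw [hA.measure_eq_iSup_isCompact, hB.measure_eq_iSup_isCompact]
  simp only [iSup_and']
  refine ENNReal.biSup_add_biSup_le' (p := fun K : Set ℝ => K ⊆ A ∧ IsCompact K)
    (q := fun K : Set ℝ => K ⊆ B ∧ IsCompact K) ⟨∅, by simp⟩ ⟨∅, by simp⟩ ?_
  rintro K ⟨hKA, hK⟩ L ⟨hLB, hL⟩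
  refine le_trans ?_ (compact_case (insert a K) (insert b L) (hK.insert a) (hL.insert b)
    (insert_nonempty _ _) (insert_nonempty _ _) (insert_subset ha hKA) (insert_subset hb hLB))
  gcongr <;> exact subset_insert _ _

/-- One-dimensional Prékopa–Leindler inequality for functions with essential height one,
in its stronger arithmetic form. -/
theorem lintegral_arith_le_of_superlevel {l m : ℝ} (hl : 0 < l) (hm : 0 < m)
    {f g h : ℝ → ℝ} (hf : Measurable f) (hg : Measurable g) (hh : Measurable h)
    (hf0 : ∀ x, 0 ≤ f x) (hg0 : ∀ x, 0 ≤ g x) (hh0 : ∀ x, 0 ≤ h x)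
    (hf1 : ∀ x, f x ≤ 1) (hg1 : ∀ x, g x ≤ 1)
    (hfs : ∀ s < 1, ∃ x, s < f x) (hgs : ∀ s < 1, ∃ x, s < g x)
    (H : ∀ x y s, s < f x → s < g y → s < h (l * x + m * y)) :
    ENNReal.ofReal l * (∫⁻ x, ENNReal.ofReal (f x)) + ENNReal.ofReal m *
      (∫⁻ x, ENNReal.ofReal (g x)) ≤ ∫⁻ x, ENNReal.ofReal (h x) := by
  have meas : ∀ {u : ℝ → ℝ}, Measurable fun s : ℝ => volume {x | s < u x} := by
    intro u
    refine Antitone.measurable fun s t hst => measure_mono fun x hx => lt_of_le_of_lt hst hx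
  rw [lintegral_eq_lintegral_meas_lt _ (.of_forall hf0) hf.aemeasurable,
    lintegral_eq_lintegral_meas_lt _ (.of_forall hg0) hg.aemeasurable,
    lintegral_eq_lintegral_meas_lt _ (.of_forall hh0) hh.aemeasurable,
    ← lintegral_const_mul _ meas, ← lintegral_const_mul _ meas,
    ← lintegral_add_left (meas.const_mul _)]
  refine lintegral_mono fun s => ?_
  rcases lt_or_ge s 1 with hs | hs
  · have scale : ∀ {c : ℝ} (_ : 0 < c) (D : Set ℝ),
        ENNReal.ofReal c * volume D = volume ((fun x => c * x) '' D) := by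
      intro c hc D
      have := Measure.addHaar_image_homothety (μ := (volume : Measure ℝ)) 0 c D
      simp only [Module.finrank_self, pow_one, abs_of_pos hc] at this
      rw [← this]
      congr 1
      ext x
      simp [AffineMap.homothety_apply]
    rw [scale hl, scale hm]
    have mscale : ∀ {c : ℝ} (_ : 0 < c) {D : Set ℝ}, MeasurableSet D →
        MeasurableSet ((fun x => c * x) '' D) := fun {c} hc D hD =>
      (MeasurableEquiv.mulLeft₀ c hc.ne').measurableSet_image.2 hD
    obtain ⟨x, hx⟩ := hfs s hs
    obtain ⟨y, hy⟩ := hgs s hs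
    refine Real.volume_add_volume_le (mscale hl (measurableSet_lt measurable_const hf))
      (mscale hm (measurableSet_lt measurable_const hg)) ⟨_, x, hx, rfl⟩ ⟨_, y, hy, rfl⟩ ?_
    rintro _ ⟨x, hx, rfl⟩ _ ⟨y, hy, rfl⟩
    exact H x y s hx hy
  · have : {x | s < f x} = ∅ := by
      ext x; simpa using (hf1 x).trans hs
    have h2 : {x | s < g x} = ∅ := by
      ext x; simpa using (hg1 x).trans hs
    simp [this, h2]

theorem ENNReal.geom_mean_le_arith_mean2 {l m : ℝ} (hl : 0 < l) (hm : 0 < m) (hlm : l + m = 1)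
    (a b : ℝ≥0∞) : a ^ l * b ^ m ≤ ENNReal.ofReal l * a + ENNReal.ofReal m * b := by
  by_cases ha : a = ⊤
  · subst ha; simp [ENNReal.mul_top, hl]
  by_cases hb : b = ⊤
  · subst hb; simp [ENNReal.mul_top, hm]
  lift a to ℝ≥0 using ha
  lift b to ℝ≥0 using hb
  have := NNReal.geom_mean_le_arith_mean2_weighted ⟨l, hl.le⟩ ⟨m, hm.le⟩ a b
    (NNReal.eq hlm)
  rw [← ENNReal.coe_rpow_of_nonneg _ hl.le, ← ENNReal.coe_rpow_of_nonneg _ hm.le,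
    ENNReal.ofReal_eq_coe_nnreal hl.le, ENNReal.ofReal_eq_coe_nnreal hm.le]
  exact_mod_cast this

/-- One-dimensional Prékopa–Leindler inequality for bounded functions. -/
theorem prekopa_leindler_real {l m : ℝ} (hl : 0 < l) (hm : 0 < m) (hlm : l + m = 1)
    {f g h : ℝ → ℝ≥0∞} (hf : Measurable f) (hg : Measurable g) (hh : Measurable h)
    (hft : ⨆ x, f x ≠ ⊤) (hgt : ⨆ x, g x ≠ ⊤)
    (H : ∀ x y, f x ^ l * g y ^ m ≤ h (l * x + m * y)) :
    (∫⁻ x, f x) ^ l * (∫⁻ x, g x) ^ m ≤ ∫⁻ x, h x := by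
  set a := ⨆ x, f x with ha
  set b := ⨆ x, g x with hb
  have hfa : ∀ x, f x ≤ a := le_iSup f
  have hgb : ∀ x, g x ≤ b := le_iSup g
  by_cases ha0 : a = 0
  · have : ∀ x, f x = 0 := fun x => le_antisymm (ha0 ▸ hfa x) bot_le
    simp [this, hl]
  by_cases hb0 : b = 0
  · have : ∀ x, g x = 0 := fun x => le_antisymm (hb0 ▸ hgb x) bot_le
    simp [this, hm]
  set c := a ^ l * b ^ m with hc
  have hc0 : c ≠ 0 := mul_ne_zero (by simp [ENNReal.rpow_eq_zero_iff, ha0, hft])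
    (by simp [ENNReal.rpow_eq_zero_iff, hb0, hgt])
  have hct : c ≠ ⊤ := ENNReal.mul_ne_top (ENNReal.rpow_ne_top_of_nonneg hl.le hft)
    (ENNReal.rpow_ne_top_of_nonneg hm.le hgt)
  have div_le : ∀ {u v : ℝ≥0∞}, v ≠ 0 → v ≠ ⊤ → u ≤ v → u / v ≤ 1 := fun hv hv' h =>
    ENNReal.div_le_of_le_mul (by simpa using h)
  have exists_lt : ∀ {u : ℝ → ℝ≥0∞} {d : ℝ≥0∞}, d = ⨆ x, u x → d ≠ 0 → d ≠ ⊤ →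
      ∀ s < (1 : ℝ), ∃ x, s < (u x / d).toReal := by
    intro u d hd hd0 hdt s hs
    rcases lt_or_ge s 0 with hs0 | hs0
    · exact ⟨0, hs0.trans_le ENNReal.toReal_nonneg⟩
    have h1 : ENNReal.ofReal s * d < ⨆ x, u x := by
      rw [← hd]
      calc ENNReal.ofReal s * d < 1 * d := by
            refine (ENNReal.mul_lt_mul_iff_left hd0 hdt).2 ?_
            rw [← ENNReal.ofReal_one]
            exact (ENNReal.ofReal_lt_ofReal_iff one_pos).2 hs
        _ = d := one_mul d
    obtain ⟨x, hx⟩ := lt_iSup_iff.1 h1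
    refine ⟨x, ?_⟩
    rw [← ENNReal.ofReal_lt_iff_lt_toReal hs0
      (ne_top_of_le_ne_top ENNReal.one_ne_top (div_le hd0 hdt (by rw [hd]; exact le_iSup u x)))]
    rwa [ENNReal.lt_div_iff_mul_lt (.inl hd0) (.inl hdt)]
  have key := lintegral_arith_le_of_superlevel hl hm (f := fun x => (f x / a).toReal)
    (g := fun x => (g x / b).toReal) (h := fun x => (min (h x / c) 1).toReal)
    (hf.div_const a).ennreal_toReal (hg.div_const b).ennreal_toReal
    ((hh.div_const c).min measurable_const).ennreal_toReal
    (fun _ => ENNReal.toReal_nonneg) (fun _ => ENNReal.toReal_nonneg)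
    (fun _ => ENNReal.toReal_nonneg)
    (fun x => ENNReal.toReal_le_of_le_ofReal zero_le_one (by simpa using div_le ha0 hft (hfa x)))
    (fun x => ENNReal.toReal_le_of_le_ofReal zero_le_one (by simpa using div_le hb0 hgt (hgb x)))
    (exists_lt ha ha0 hft) (exists_lt hb hb0 hgt) ?_
  · have e1 : ∀ x, ENNReal.ofReal (f x / a).toReal = f x / a := fun x =>
      ENNReal.ofReal_toReal (ne_top_of_le_ne_top ENNReal.one_ne_top (div_le ha0 hft (hfa x)))
    have e2 : ∀ x, ENNReal.ofReal (g x / b).toReal = g x / b := fun x =>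
      ENNReal.ofReal_toReal (ne_top_of_le_ne_top ENNReal.one_ne_top (div_le hb0 hgt (hgb x)))
    simp only [e1, e2] at key
    have h3 : ∫⁻ x, ENNReal.ofReal (min (h x / c) 1).toReal ≤ (∫⁻ x, h x) / c := by
      simp_rw [ENNReal.div_eq_inv_mul]
      rw [← lintegral_const_mul _ hh]
      refine lintegral_mono fun x => ?_
      rw [ENNReal.ofReal_toReal (ne_top_of_le_ne_top ENNReal.one_ne_top (min_le_right _ _))]
      exact min_le_left _ _
    have h4 := ((ENNReal.geom_mean_le_arith_mean2 hl hm hlm _ _).trans key).trans h3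
    simp_rw [ENNReal.div_eq_inv_mul] at h4
    rw [lintegral_const_mul _ hf, lintegral_const_mul _ hg, ← ENNReal.div_eq_inv_mul,
      ← ENNReal.div_eq_inv_mul, ← ENNReal.div_eq_inv_mul, ENNReal.div_rpow_of_nonneg _ _ hl.le,
      ENNReal.div_rpow_of_nonneg _ _ hm.le, ENNReal.le_div_iff_mul_le (.inl hc0) (.inl hct)] at h4
    refine le_trans (le_of_eq ?_) h4
    have ca : a ^ l ≠ 0 := left_ne_zero_of_mul hc0
    have cb : b ^ m ≠ 0 := right_ne_zero_of_mul hc0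
    have cat : a ^ l ≠ ⊤ := ENNReal.rpow_ne_top_of_nonneg hl.le hft
    have cbt : b ^ m ≠ ⊤ := ENNReal.rpow_ne_top_of_nonneg hm.le hgt
    rw [hc, mul_mul_mul_comm, ENNReal.div_mul_cancel ca cat, ENNReal.div_mul_cancel cb cbt]
  · intro x y s hsx hsy
    rcases lt_or_ge s 0 with hs0 | hs0
    · exact hs0.trans_le ENNReal.toReal_nonneg
    have htop : min (h (l * x + m * y) / c) 1 ≠ ⊤ :=
      ne_top_of_le_ne_top ENNReal.one_ne_top (min_le_right _ _)
    have hx1 := div_le ha0 hft (hfa x)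
    have hy1 := div_le hb0 hgt (hgb y)
    rw [← ENNReal.ofReal_lt_iff_lt_toReal hs0 (ne_top_of_le_ne_top ENNReal.one_ne_top hx1)] at hsx
    rw [← ENNReal.ofReal_lt_iff_lt_toReal hs0 (ne_top_of_le_ne_top ENNReal.one_ne_top hy1)] at hsy
    rw [← ENNReal.ofReal_lt_iff_lt_toReal hs0 htop]
    refine lt_min ?_ (hsx.trans_le hx1)
    calc ENNReal.ofReal s = ENNReal.ofReal s ^ l * ENNReal.ofReal s ^ m := by
          rw [← ENNReal.rpow_add_of_nonneg _ _ hl.le hm.le, hlm, ENNReal.rpow_one]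
      _ < (f x / a) ^ l * (g y / b) ^ m :=
          ENNReal.mul_lt_mul (ENNReal.rpow_lt_rpow hsx hl) (ENNReal.rpow_lt_rpow hsy hm)
      _ = f x ^ l * g y ^ m / c := by
          rw [ENNReal.div_rpow_of_nonneg _ _ hl.le, ENNReal.div_rpow_of_nonneg _ _ hm.le, hc,
            ENNReal.mul_div_mul_comm (.inr (ENNReal.rpow_ne_top_of_nonneg hm.le hgt)) (.inl (ENNReal.rpow_ne_top_of_nonneg hl.le hft))]
      _ ≤ h (l * x + m * y) / c := ENNReal.div_le_div_right (H x y) _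

theorem piFinSuccAbove_zero_symm_apply {n : ℕ} (x : ℝ) (z : Fin n → ℝ) :
    (MeasurableEquiv.piFinSuccAbove (fun _ : Fin (n + 1) => ℝ) 0).symm (x, z) =
      (Fin.cons x z : Fin (n + 1) → ℝ) :=
  Fin.insertNth_zero' x z

theorem volume_eq_lintegral_cons {n : ℕ} {A : Set (Fin (n + 1) → ℝ)} (hA : MeasurableSet A) :
    volume A = ∫⁻ x : ℝ, volume {z : Fin n → ℝ | (Fin.cons x z : Fin (n + 1) → ℝ) ∈ A} := by
  have e := (volume_preserving_piFinSuccAbove (fun _ : Fin (n + 1) => ℝ) 0).symm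
  rw [← e.measure_preimage hA.nullMeasurableSet]
  rw [Measure.volume_eq_prod, Measure.prod_apply (e.measurable hA)]
  simp only [preimage, mem_ofPred_eq, piFinSuccAbove_zero_symm_apply]

theorem measurable_cons_slice {n : ℕ} {A : Set (Fin (n + 1) → ℝ)} (hA : MeasurableSet A) :
    (∀ x : ℝ, MeasurableSet {z : Fin n → ℝ | (Fin.cons x z : Fin (n + 1) → ℝ) ∈ A}) ∧
    Measurable fun x : ℝ => volume {z : Fin n → ℝ | (Fin.cons x z : Fin (n + 1) → ℝ) ∈ A} := by
  have e := (MeasurableEquiv.piFinSuccAbove (fun _ : Fin (n + 1) => ℝ) 0).symm.measurable hA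
  have h1 := fun x : ℝ => measurable_prodMk_left (x := x) e
  have h2 := measurable_measure_prodMk_left (ν := (volume : Measure (Fin n → ℝ))) e
  simp only [preimage, mem_ofPred_eq, piFinSuccAbove_zero_symm_apply] at h1 h2
  exact ⟨h1, h2⟩

/-- Multiplicative Brunn–Minkowski inequality for bounded subsets of `Fin n → ℝ`. -/
theorem brunn_minkowski_multiplicative_pi {l m : ℝ} (hl : 0 < l) (hm : 0 < m) (hlm : l + m = 1)
    (n : ℕ) (A B C : Set (Fin n → ℝ)) (hA : MeasurableSet A) (hB : MeasurableSet B)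
    (hC : MeasurableSet C) (hAb : Bornology.IsBounded A) (hBb : Bornology.IsBounded B)
    (H : ∀ a ∈ A, ∀ b ∈ B, l • a + m • b ∈ C) :
    volume A ^ l * volume B ^ m ≤ volume C := by
  induction n with
  | zero =>
    rcases A.eq_empty_or_nonempty with rfl | ⟨a, ha⟩
    · simp [hl]
    rcases B.eq_empty_or_nonempty with rfl | ⟨b, hb⟩
    · simp [hm]
    have univ_of : ∀ {D : Set (Fin 0 → ℝ)} {d}, d ∈ D → D = univ := fun {D d} hd =>
      eq_univ_of_forall fun x => Subsingleton.elim d x ▸ hd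
    rw [univ_of ha, univ_of hb, univ_of (H a ha b hb)]
    simp [volume_pi]
  | succ n ih =>
    have slice_bdd : ∀ {D : Set (Fin (n + 1) → ℝ)}, Bornology.IsBounded D →
        ∃ r : ℝ, ∀ x : ℝ, {z : Fin n → ℝ | (Fin.cons x z : Fin (n + 1) → ℝ) ∈ D} ⊆
          closedBall 0 r := by
      intro D hD
      obtain ⟨r, hr⟩ := hD.subset_closedBall 0
      refine ⟨r, fun x z hz => ?_⟩
      have h1 := hr hz
      rw [mem_closedBall_zero_iff] at h1 ⊢
      have hr0 : 0 ≤ r := (norm_nonneg _).trans h1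
      rw [pi_norm_le_iff_of_nonneg hr0] at h1 ⊢
      intro i
      simpa using h1 i.succ
    obtain ⟨ra, hra⟩ := slice_bdd hAb
    obtain ⟨rb, hrb⟩ := slice_bdd hBb
    have fin_of : ∀ {D : Set (Fin (n + 1) → ℝ)} {r : ℝ}, (∀ x : ℝ,
        {z : Fin n → ℝ | (Fin.cons x z : Fin (n + 1) → ℝ) ∈ D} ⊆ closedBall 0 r) →
        ⨆ x : ℝ, volume {z : Fin n → ℝ | (Fin.cons x z : Fin (n + 1) → ℝ) ∈ D} ≠ ⊤ :=
      fun {D r} h => ne_top_of_le_ne_top (measure_closedBall_lt_top (x := 0) (r := r)).ne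
        (iSup_le fun x => measure_mono (h x))
    rw [volume_eq_lintegral_cons hA, volume_eq_lintegral_cons hB, volume_eq_lintegral_cons hC]
    refine prekopa_leindler_real hl hm hlm (measurable_cons_slice hA).2
      (measurable_cons_slice hB).2 (measurable_cons_slice hC).2 (fin_of hra) (fin_of hrb) ?_
    intro x y
    refine ih _ _ _ ((measurable_cons_slice hA).1 x) ((measurable_cons_slice hB).1 y)
      ((measurable_cons_slice hC).1 _) (isBounded_closedBall.subset (hra x))
      (isBounded_closedBall.subset (hrb y)) ?_
    intro a ha b hb
    have := H _ ha _ hb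
    rw [mem_ofPred_eq]
    convert this using 1
    ext i
    refine Fin.cases ?_ (fun j => ?_) i <;> simp

/-- Multiplicative Brunn–Minkowski inequality for bounded subsets of Euclidean space. -/
theorem brunn_minkowski_multiplicative {l m : ℝ} (hl : 0 < l) (hm : 0 < m) (hlm : l + m = 1)
    {n : ℕ} {A B C : Set (EuclideanSpace ℝ (Fin n))} (hA : MeasurableSet A)
    (hB : MeasurableSet B) (hC : MeasurableSet C) (hAb : Bornology.IsBounded A)
    (hBb : Bornology.IsBounded B) (H : ∀ a ∈ A, ∀ b ∈ B, l • a + m • b ∈ C) :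
    volume A ^ l * volume B ^ m ≤ volume C := by
  have e := PiLp.volume_preserving_toLp (Fin n)
  rw [← e.measure_preimage hA.nullMeasurableSet, ← e.measure_preimage hB.nullMeasurableSet,
    ← e.measure_preimage hC.nullMeasurableSet]
  have bdd : ∀ {D : Set (EuclideanSpace ℝ (Fin n))}, Bornology.IsBounded D →
      Bornology.IsBounded ((WithLp.toLp 2 : (Fin n → ℝ) → _) ⁻¹' D) := fun {D} hD =>
    (PiLp.antilipschitzWith_toLp 2 (fun _ : Fin n => ℝ)).isBounded_preimage hD
  refine brunn_minkowski_multiplicative_pi hl hm hlm n _ _ _ (e.measurable hA) (e.measurable hB)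
    (e.measurable hC) (bdd hAb) (bdd hBb) fun a ha b hb => ?_
  exact H _ ha _ hb

open scoped Pointwise in
/-- Brunn–Minkowski inequality in the form giving the first variation of volume. -/
theorem volume_add_le_volume_minkowski {n : ℕ} (hn : 0 < n)
    {A B C : Set (EuclideanSpace ℝ (Fin n))} (hA : MeasurableSet A)
    (hB : MeasurableSet B) (hC : MeasurableSet C) (hAb : Bornology.IsBounded A)
    (hBb : Bornology.IsBounded B) {t : ℝ} (ht : 0 < t) (hA0 : volume A ≠ 0)
    (hB0 : volume B ≠ 0) (H : ∀ a ∈ A, ∀ b ∈ B, a + t • b ∈ C) :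
    volume A + ENNReal.ofReal (n * t) * volume B ^ (1 / n : ℝ) *
      volume A ^ (((n : ℝ) - 1) / n) ≤ volume C := by
  have hn' : (0 : ℝ) < n := by exact_mod_cast hn
  have root : ∀ {D : Set (EuclideanSpace ℝ (Fin n))}, Bornology.IsBounded D → volume D ≠ 0 →
      ∃ f : ℝ, 0 < f ∧ volume D = ENNReal.ofReal f ^ n := by
    intro D hD h0
    refine ⟨(volume D ^ (1 / n : ℝ)).toReal, ENNReal.toReal_pos ?_ ?_, ?_⟩
    · simp [ENNReal.rpow_eq_zero_iff, h0, hD.measure_lt_top.ne]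
    · exact ENNReal.rpow_ne_top_of_nonneg (by positivity) hD.measure_lt_top.ne
    · rw [ENNReal.ofReal_toReal (ENNReal.rpow_ne_top_of_nonneg (by positivity)
        hD.measure_lt_top.ne), ← ENNReal.rpow_natCast, ← ENNReal.rpow_mul,
        one_div_mul_cancel hn'.ne', ENNReal.rpow_one]
  obtain ⟨f, hf, hfA⟩ := root hAb hA0
  obtain ⟨k, hk, hkB⟩ := root hBb hB0
  set l := f / (f + t * k) with hl
  set m := t * k / (f + t * k) with hm
  have hl0 : 0 < l := by positivity
  have hm0 : 0 < m := by positivity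
  have hlm : l + m = 1 := by rw [hl, hm]; field_simp
  have smul_meas : ∀ {r : ℝ} (_ : 0 < r) {D : Set (EuclideanSpace ℝ (Fin n))},
      MeasurableSet D → MeasurableSet (r • D) := fun hr _ hD => hD.const_smul₀ _
  have key := brunn_minkowski_multiplicative hl0 hm0 hlm (A := l⁻¹ • A) (B := (t / m) • B)
    (smul_meas (by positivity) hA) (smul_meas (by positivity) hB) hC (hAb.smul₀ _) (hBb.smul₀ _) ?_
  · have e1 : volume (l⁻¹ • A) = ENNReal.ofReal (f + t * k) ^ n := by
      rw [Measure.addHaar_smul_of_nonneg _ (by positivity), hfA, finrank_euclideanSpace_fin,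
        ENNReal.ofReal_pow (by positivity), ← mul_pow, ← ENNReal.ofReal_mul (by positivity)]
      congr 2
      rw [hl]; field_simp
    have e2 : volume ((t / m) • B) = ENNReal.ofReal (f + t * k) ^ n := by
      rw [Measure.addHaar_smul_of_nonneg _ (by positivity), hkB, finrank_euclideanSpace_fin,
        ENNReal.ofReal_pow (by positivity), ← mul_pow, ← ENNReal.ofReal_mul (by positivity)]
      congr 2
      rw [hm]; field_simp
    rw [e1, e2, ← ENNReal.rpow_add_of_nonneg _ _ hl0.le hm0.le, hlm, ENNReal.rpow_one] at key
    refine le_trans ?_ key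
    rw [hfA, hkB, ← ENNReal.rpow_natCast, ← ENNReal.rpow_natCast, ← ENNReal.rpow_natCast,
      ← ENNReal.rpow_mul, ← ENNReal.rpow_mul, mul_one_div_cancel hn'.ne', ENNReal.rpow_one,
      mul_div_cancel₀ _ hn'.ne', ENNReal.ofReal_rpow_of_pos hf, ENNReal.ofReal_rpow_of_pos hf,
      ENNReal.ofReal_rpow_of_pos (by positivity), ← ENNReal.ofReal_mul (by positivity),
      ← ENNReal.ofReal_mul (by positivity), ← ENNReal.ofReal_add (by positivity) (by positivity)]
    refine ENNReal.ofReal_le_ofReal ?_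
    have bern := one_add_mul_self_le_rpow_one_add (s := t * k / f) (p := n)
      (by have : 0 < t * k / f := by positivity
          linarith) (by exact_mod_cast hn)
    calc f ^ (n : ℝ) + n * t * k * f ^ ((n : ℝ) - 1)
        = f ^ (n : ℝ) * (1 + n * (t * k / f)) := by
          rw [Real.rpow_sub_one hf.ne']; field_simp
      _ ≤ f ^ (n : ℝ) * (1 + t * k / f) ^ (n : ℝ) := by gcongr
      _ = (f + t * k) ^ (n : ℝ) := by
          rw [← Real.mul_rpow hf.le (by positivity)]
          congr 1; field_simp
  · rintro _ ⟨a, ha, rfl⟩ _ ⟨b, hb, rfl⟩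
    convert H a ha b hb using 1
    simp only [smul_smul]
    rw [mul_inv_cancel₀ hl0.ne', one_smul, mul_div_cancel₀ _ hm0.ne']

/-- A possibly asymmetric gauge on Euclidean space comparable with the Euclidean norm. -/
structure IsGauge {N : ℕ} (ρ : EuclideanSpace ℝ (Fin N) → ℝ) : Prop where
  add_le : ∀ x y, ρ (x + y) ≤ ρ x + ρ y
  smul_eq : ∀ t : ℝ, 0 ≤ t → ∀ x, ρ (t • x) = t * ρ x
  lower : ∃ c : ℝ, 0 < c ∧ ∀ x, c * ‖x‖ ≤ ρ x
  upper : ∃ C : ℝ, 0 < C ∧ ∀ x, ρ x ≤ C * ‖x‖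

theorem IsAnisoNorm.map_zero {N : ℕ} {H : EuclideanSpace ℝ (Fin N) → ℝ} (hH : IsAnisoNorm H) :
    H 0 = 0 := by
  simpa using hH.hom 0 0

theorem IsAnisoNorm.exists_bounds {N : ℕ} (hN : 0 < N) {H : EuclideanSpace ℝ (Fin N) → ℝ}
    (hH : IsAnisoNorm H) (hc : ContinuousOn H {0}ᶜ) :
    ∃ c C : ℝ, 0 < c ∧ 0 < C ∧ ∀ ξ, c * ‖ξ‖ ≤ H ξ ∧ H ξ ≤ C * ‖ξ‖ := by
  have : Nonempty (Fin N) := ⟨⟨0, hN⟩⟩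
  have hcs : ContinuousOn H (sphere 0 1) := hc.mono fun x hx => by
    rw [mem_sphere_zero_iff_norm] at hx
    rw [mem_compl_iff, mem_singleton_iff]
    rintro rfl
    simp at hx
  have hne : (sphere (0 : EuclideanSpace ℝ (Fin N)) 1).Nonempty :=
    NormedSpace.sphere_nonempty.2 zero_le_one
  obtain ⟨a, ha, hamin⟩ := (isCompact_sphere _ _).exists_isMinOn hne hcs
  obtain ⟨b, hb, hbmax⟩ := (isCompact_sphere _ _).exists_isMaxOn hne hcs
  have hpos : ∀ x ∈ sphere (0 : EuclideanSpace ℝ (Fin N)) 1, 0 < H x := fun x hx => by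
    refine hH.pos x ?_
    rintro rfl
    simp at hx
  refine ⟨H a, H b, hpos a ha, hpos b hb, fun ξ => ?_⟩
  by_cases h0 : ξ = 0
  · simp [h0, hH.map_zero]
  have hn : 0 < ‖ξ‖ := norm_pos_iff.2 h0
  have hmem : ‖ξ‖⁻¹ • ξ ∈ sphere (0 : EuclideanSpace ℝ (Fin N)) 1 := by
    rw [mem_sphere_zero_iff_norm, norm_smul, norm_inv, norm_norm, inv_mul_cancel₀ hn.ne']
  have e : H ξ = H (‖ξ‖⁻¹ • ξ) * ‖ξ‖ := by
    rw [hH.hom, abs_of_pos (inv_pos.2 hn)]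
    field_simp
  rw [e]
  exact ⟨mul_le_mul_of_nonneg_right (hamin hmem) hn.le,
    mul_le_mul_of_nonneg_right (hbmax hmem) hn.le⟩

theorem IsAnisoNorm.isGauge_dualNorm {N : ℕ} (hN : 0 < N) {H : EuclideanSpace ℝ (Fin N) → ℝ}
    (hH : IsAnisoNorm H) (hc : ContinuousOn H {0}ᶜ) : IsGauge (dualNorm H) := by
  have : Nonempty (Fin N) := ⟨⟨0, hN⟩⟩
  obtain ⟨c, C, hc0, hC0, hb⟩ := hH.exists_bounds hN hc
  obtain ⟨ξ₀, hξ₀⟩ := exists_ne (0 : EuclideanSpace ℝ (Fin N))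
  have up : ∀ x ξ : EuclideanSpace ℝ (Fin N), ξ ≠ 0 → ⟪x, ξ⟫ / H ξ ≤ c⁻¹ * ‖x‖ := by
    intro x ξ hξ
    rw [div_le_iff₀ (hH.pos ξ hξ)]
    calc ⟪x, ξ⟫ ≤ ‖x‖ * ‖ξ‖ := real_inner_le_norm x ξ
      _ = c⁻¹ * ‖x‖ * (c * ‖ξ‖) := by field_simp
      _ ≤ c⁻¹ * ‖x‖ * H ξ := by gcongr; exact (hb ξ).1
  have bdd : ∀ x, BddAbove ((fun ξ => ⟪x, ξ⟫ / H ξ) ''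
      {ξ : EuclideanSpace ℝ (Fin N) | ξ ≠ 0}) := by
    rintro x
    refine ⟨c⁻¹ * ‖x‖, ?_⟩
    rintro _ ⟨ξ, hξ, rfl⟩
    exact up x ξ hξ
  have le_dual : ∀ x ξ, ξ ≠ 0 → ⟪x, ξ⟫ / H ξ ≤ dualNorm H x := fun x ξ hξ =>
    le_csSup (bdd x) ⟨ξ, hξ, rfl⟩
  have dual_le : ∀ x r, (∀ ξ, ξ ≠ 0 → ⟪x, ξ⟫ / H ξ ≤ r) → dualNorm H x ≤ r := by
    intro x r h
    refine csSup_le ⟨_, ξ₀, hξ₀, rfl⟩ ?_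
    rintro _ ⟨ξ, hξ, rfl⟩
    exact h ξ hξ
  have smul_le : ∀ t : ℝ, 0 ≤ t → ∀ x, dualNorm H (t • x) ≤ t * dualNorm H x := by
    intro t ht x
    refine dual_le _ _ fun ξ hξ => ?_
    rw [real_inner_smul_left, mul_div_assoc]
    exact mul_le_mul_of_nonneg_left (le_dual x ξ hξ) ht
  refine ⟨fun x y => dual_le _ _ fun ξ hξ => ?_, fun t ht x => ?_, ⟨C⁻¹, by positivity, ?_⟩,
    ⟨c⁻¹, by positivity, fun x => dual_le _ _ (up x)⟩⟩
  · rw [inner_add_left, add_div]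
    exact add_le_add (le_dual x ξ hξ) (le_dual y ξ hξ)
  · refine le_antisymm (smul_le t ht x) ?_
    rcases ht.eq_or_lt with rfl | ht
    · have := le_dual (0 : EuclideanSpace ℝ (Fin N)) ξ₀ hξ₀
      simpa using this
    have := smul_le t⁻¹ (by positivity) (t • x)
    rw [smul_smul, inv_mul_cancel₀ ht.ne', one_smul] at this
    calc t * dualNorm H x ≤ t * (t⁻¹ * dualNorm H (t • x)) := by gcongr
      _ = dualNorm H (t • x) := by field_simp
  · intro x
    by_cases hx : x = 0
    · have := le_dual x ξ₀ hξ₀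
      simpa [hx] using this
    refine le_trans ?_ (le_dual x x hx)
    rw [le_div_iff₀ (hH.pos x hx), real_inner_self_eq_norm_sq]
    calc C⁻¹ * ‖x‖ * H x ≤ C⁻¹ * ‖x‖ * (C * ‖x‖) := by gcongr; exact (hb x).2
      _ = ‖x‖ ^ 2 := by field_simp

namespace IsGauge

variable {N : ℕ} {ρ : EuclideanSpace ℝ (Fin N) → ℝ}

theorem map_zero (h : IsGauge ρ) : ρ 0 = 0 := by
  simpa using h.smul_eq 0 le_rfl 0

theorem nonneg (h : IsGauge ρ) (x) : 0 ≤ ρ x := by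
  obtain ⟨c, hc, hx⟩ := h.lower
  exact (by positivity : (0 : ℝ) ≤ c * ‖x‖).trans (hx x)

theorem continuous (h : IsGauge ρ) : Continuous ρ := by
  obtain ⟨C, hC, hup⟩ := h.upper
  refine (LipschitzWith.of_le_add_mul C.toNNReal fun x y => ?_).continuous
  rw [Real.coe_toNNReal _ hC.le, dist_eq_norm]
  calc ρ x = ρ (y + (x - y)) := by congr 1; abel
    _ ≤ ρ y + ρ (x - y) := h.add_le _ _
    _ ≤ ρ y + C * ‖x - y‖ := by gcongr; exact hup _

theorem isBounded_ball (h : IsGauge ρ) (r : ℝ) : Bornology.IsBounded {x | ρ x < r} := by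
  obtain ⟨c, hc, hx⟩ := h.lower
  refine isBounded_closedBall.subset (t := closedBall 0 (r / c)) fun x hr => ?_
  rw [mem_closedBall_zero_iff, le_div_iff₀ hc, mul_comm]
  exact (hx x).trans (le_of_lt hr)

theorem isOpen_ball (h : IsGauge ρ) (r : ℝ) : IsOpen {x | ρ x < r} :=
  isOpen_lt h.continuous continuous_const

theorem sum_le (h : IsGauge ρ) {ι : Type*} (s : Finset ι) (w : ι → ℝ)
    (y : ι → EuclideanSpace ℝ (Fin N)) (hw : ∀ i ∈ s, 0 ≤ w i) (hy : ∀ i ∈ s, ρ (y i) ≤ 1) :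
    ρ (∑ i ∈ s, w i • y i) ≤ ∑ i ∈ s, w i := by
  induction s using Finset.induction_on with
  | empty => simp [h.map_zero]
  | insert a s ha ih =>
    rw [Finset.sum_insert ha, Finset.sum_insert ha]
    refine (h.add_le _ _).trans (add_le_add ?_ (ih (fun i hi => hw i (by simp [hi]))
      fun i hi => hy i (by simp [hi])))
    rw [h.smul_eq _ (hw a (by simp))]
    exact mul_le_of_le_one_right (hw a (by simp)) (hy a (by simp))

end IsGauge

theorem vdiv_eq_trace {N : ℕ} (σ : EuclideanSpace ℝ (Fin N) → EuclideanSpace ℝ (Fin N))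
    (x : EuclideanSpace ℝ (Fin N)) :
    vdiv σ x = LinearMap.trace ℝ _ (fderiv ℝ σ x : EuclideanSpace ℝ (Fin N) →ₗ[ℝ] _) := by
  rw [LinearMap.trace_eq_matrix_trace ℝ (EuclideanSpace.basisFun (Fin N) ℝ).toBasis]
  simp [vdiv, Matrix.trace, LinearMap.toMatrix_apply]

theorem det_one_add_isLittleO_trace {N : ℕ} :
    (fun A : EuclideanSpace ℝ (Fin N) →L[ℝ] EuclideanSpace ℝ (Fin N) =>
      (1 + A).det - 1 - LinearMap.trace ℝ _ (A : EuclideanSpace ℝ (Fin N) →ₗ[ℝ] _))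
      =o[𝓝 0] fun A => A := by
  set b := (EuclideanSpace.basisFun (Fin N) ℝ).toBasis
  set F : (EuclideanSpace ℝ (Fin N) →L[ℝ] EuclideanSpace ℝ (Fin N)) → ℝ :=
    fun A => (1 + A).det with hF
  have hFm : ∀ A, F A = (1 + LinearMap.toMatrix b b (A : EuclideanSpace ℝ (Fin N) →ₗ[ℝ] _)).det := by
    intro A
    rw [hF]
    simp only [ContinuousLinearMap.det]
    rw [← LinearMap.det_toMatrix b]
    simp [LinearMap.toMatrix_one]
  have hFd : Differentiable ℝ F := by
    have : F = fun A : EuclideanSpace ℝ (Fin N) →L[ℝ] EuclideanSpace ℝ (Fin N) => (1 + LinearMap.toMatrix b b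
        (A : EuclideanSpace ℝ (Fin N) →ₗ[ℝ] EuclideanSpace ℝ (Fin N))).det := funext hFm
    rw [this]
    simp only [Matrix.det_apply, Matrix.add_apply, LinearMap.toMatrix_apply, b]
    simp only [OrthonormalBasis.coe_toBasis, EuclideanSpace.basisFun_apply,
      ContinuousLinearMap.coe_coe, OrthonormalBasis.coe_toBasis_repr_apply,
      EuclideanSpace.basisFun_repr]
    refine Differentiable.fun_sum fun τ _ => ?_
    refine Differentiable.fun_const_smul ?_ _
    intro A
    refine (HasFDerivAt.finsetProd (u := Finset.univ) fun i _ =>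
      DifferentiableAt.hasFDerivAt ?_).differentiableAt
    fun_prop
  have hd := (hFd 0).hasFDerivAt
  have hval : ∀ A, fderiv ℝ F 0 A =
      LinearMap.trace ℝ _ (A : EuclideanSpace ℝ (Fin N) →ₗ[ℝ] _) := by
    intro A
    have h1 : HasDerivAt (fun t : ℝ => F (t • A)) (fderiv ℝ F 0 A) 0 := by
      have hs : HasDerivAt (fun t : ℝ => t • A) A 0 := by
        simpa using (hasDerivAt_id (0 : ℝ)).smul_const A
      exact HasFDerivAt.comp_hasDerivAt_of_eq 0 hd hs (zero_smul ℝ A).symm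
    set M := LinearMap.toMatrix b b (A : EuclideanSpace ℝ (Fin N) →ₗ[ℝ] _) with hM
    have h2 : HasDerivAt (fun t : ℝ => F (t • A)) M.trace 0 := by
      have e : (fun t : ℝ => F (t • A)) = fun t : ℝ => 1 + M.trace * t +
          (Matrix.det (1 + (Polynomial.X : Polynomial ℝ) • M.map Polynomial.C)).divX.divX.eval t
            * t ^ 2 := by
        funext t
        rw [hFm, ← Matrix.det_one_add_smul]
        simp [hM]
      rw [e]
      have h3 := (((hasDerivAt_id (0 : ℝ)).const_mul M.trace).const_add 1).add
        ((Polynomial.hasDerivAt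
          (Matrix.det (1 + (Polynomial.X : Polynomial ℝ) • M.map Polynomial.C)).divX.divX 0).mul
          (hasDerivAt_pow 2 (0 : ℝ)))
      exact h3.congr_deriv (by simp)
    rw [h1.unique h2, LinearMap.trace_eq_matrix_trace ℝ b]
  have := hasFDerivAt_iff_isLittleO.1 hd
  simp only [sub_zero] at this
  refine this.congr_left fun A => ?_
  rw [hval]
  simp [hF, ContinuousLinearMap.det]

theorem vdiv_eq_zero_of_notMem {N : ℕ} {σ : EuclideanSpace ℝ (Fin N) → EuclideanSpace ℝ (Fin N)}
    {x : EuclideanSpace ℝ (Fin N)} (hx : x ∉ tsupport σ) : vdiv σ x = 0 := by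
  simp [vdiv, fderiv_of_notMem_tsupport ℝ hx]

theorem continuous_vdiv {N : ℕ} {σ : EuclideanSpace ℝ (Fin N) → EuclideanSpace ℝ (Fin N)}
    (hσ : ContDiff ℝ 1 σ) : Continuous (vdiv σ) := by
  have := hσ.continuous_fderiv one_ne_zero
  unfold vdiv
  fun_prop

theorem hasCompactSupport_vdiv {N : ℕ}
    {σ : EuclideanSpace ℝ (Fin N) → EuclideanSpace ℝ (Fin N)} (hσ : HasCompactSupport σ) :
    HasCompactSupport (vdiv σ) :=
  HasCompactSupport.intro hσ fun _ hx => vdiv_eq_zero_of_notMem hx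

theorem integrable_vdiv {N : ℕ} {σ : EuclideanSpace ℝ (Fin N) → EuclideanSpace ℝ (Fin N)}
    (hσ : ContDiff ℝ 1 σ) (hc : HasCompactSupport σ) : Integrable (vdiv σ) :=
  (continuous_vdiv hσ).integrable_of_hasCompactSupport (hasCompactSupport_vdiv hc)

theorem setIntegral_vdiv_inter {N : ℕ} {σ : EuclideanSpace ℝ (Fin N) → EuclideanSpace ℝ (Fin N)}
    {E S : Set (EuclideanSpace ℝ (Fin N))} (hS : MeasurableSet S) (hσ : tsupport σ ⊆ S) :
    ∫ x in E, vdiv σ x = ∫ x in S ∩ E, vdiv σ x := by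
  rw [inter_comm, ← setIntegral_indicator hS, indicator_eq_self.2]
  intro x hx
  by_contra h
  exact hx (vdiv_eq_zero_of_notMem fun h' => h (hσ h'))

theorem integral_le_of_lintegral_ofReal_le {α : Type*} [MeasurableSpace α] {μ : Measure α}
    {g : α → ℝ} (hg : Integrable g μ) {c : ℝ} (hc : 0 ≤ c)
    (h : ∫⁻ x, ENNReal.ofReal (g x) ∂μ ≤ ENNReal.ofReal c) : ∫ x, g x ∂μ ≤ c := by
  rw [integral_eq_lintegral_pos_part_sub_lintegral_neg_part hg]
  have := ENNReal.toReal_le_of_le_ofReal hc h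
  linarith [ENNReal.toReal_nonneg (a := ∫⁻ x, ENNReal.ofReal (-g x) ∂μ)]

open scoped Pointwise in
/-- A flow argument bounding the relative perimeter of a gauge ball in a convex cone. -/
theorem setIntegral_vdiv_ball_le {N : ℕ} {ρ : EuclideanSpace ℝ (Fin N) → ℝ} (hρ : IsGauge ρ)
    {S : Set (EuclideanSpace ℝ (Fin N))} (hS : IsOpenConvexCone S)
    {σ : EuclideanSpace ℝ (Fin N) → EuclideanSpace ℝ (Fin N)} (hσ : ContDiff ℝ 1 σ)
    (hσc : HasCompactSupport σ) (hσS : tsupport σ ⊆ S) (hσ1 : ∀ x, ρ (σ x) ≤ 1) :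
    ∫ x in {y | ρ y < 1}, vdiv σ x ≤ N * (volume (S ∩ {y | ρ y < 1})).toReal := by
  rw [setIntegral_vdiv_inter hS.1.measurableSet hσS]
  set K := S ∩ {y | ρ y < 1} with hK
  have hKo : IsOpen K := hS.1.inter (hρ.isOpen_ball 1)
  have hKt : volume K ≠ ⊤ := ((hρ.isBounded_ball 1).subset inter_subset_right).measure_lt_top.ne
  set V := (volume K).toReal with hV
  set I := ∫ x in K, vdiv σ x with hI
  obtain ⟨M, hM⟩ := hσc.exists_bound_of_continuous hσ.continuous
  obtain ⟨L₀, hL₀⟩ := (hσc.fderiv (𝕜 := ℝ)).exists_bound_of_continuous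
    (hσ.continuous_fderiv one_ne_zero)
  set L := max L₀ 1 with hL
  have hL0 : 0 < L := lt_max_of_lt_right one_pos
  have hLf : ∀ x, ‖fderiv ℝ σ x‖ ≤ L := fun x => (hL₀ x).trans (le_max_left _ _)
  have hLip : ∀ x y, ‖σ x - σ y‖ ≤ L * ‖x - y‖ := fun x y =>
    Convex.norm_image_sub_le_of_norm_fderiv_le (fun z _ => (hσ.differentiable one_ne_zero) z)
      (fun z _ => hLf z) convex_univ (mem_univ y) (mem_univ x)
  obtain ⟨δ, hδ, hδS⟩ := hσc.isCompact.exists_thickening_subset_open hS.1 hσS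
  have step : ∀ η > 0, ∀ᶠ t in 𝓝[>] (0 : ℝ),
      I ≤ t⁻¹ * ((1 + t) ^ N - 1) * V + η * L * V := by
    intro η hη
    have hdet := (det_one_add_isLittleO_trace (N := N)).def hη
    rw [Metric.eventually_nhds_iff] at hdet
    obtain ⟨ε, hε, hdet⟩ := hdet
    have small : ∀ c : ℝ, ∀ d > 0, ∀ᶠ t in 𝓝[>] (0 : ℝ), t * c < d := by
      intro c d hd
      have : Filter.Tendsto (fun t : ℝ => t * c) (𝓝[>] 0) (𝓝 0) := by
        have h : Continuous fun t : ℝ => t * c := by fun_prop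
        simpa using (h.tendsto 0).mono_left nhdsWithin_le_nhds
      exact this.eventually (gt_mem_nhds hd)
    filter_upwards [self_mem_nhdsWithin, small L 1 one_pos, small L ε hε, small M δ hδ]
      with t ht htL htε htM
    rw [mem_Ioi] at ht
    set φ : EuclideanSpace ℝ (Fin N) → EuclideanSpace ℝ (Fin N) := fun x => x + t • σ x with hφ
    have hφd : ∀ x ∈ K, HasFDerivWithinAt φ (1 + t • fderiv ℝ σ x) K x := fun x _ =>
      ((hasFDerivAt_id x).add
        ((hσ.differentiable one_ne_zero x).hasFDerivAt.const_smul t)).hasFDerivWithinAt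
    have hφi : InjOn φ K := by
      intro x _ y _ hxy
      by_contra hne
      have hn : 0 < ‖x - y‖ := norm_pos_iff.2 (sub_ne_zero.2 hne)
      have e : x - y = t • (σ y - σ x) := by
        simp only [hφ] at hxy
        rw [smul_sub, sub_eq_sub_iff_add_eq_add, hxy, add_comm]
      have h1 : ‖x - y‖ ≤ t * (L * ‖x - y‖) := by
        conv_lhs => rw [e, norm_smul, Real.norm_of_nonneg ht.le]
        rw [norm_sub_rev x y]
        gcongr
        exact hLip y x
      nlinarith
    have hφK : φ '' K ⊆ (1 + t) • K := by
      rintro _ ⟨x, ⟨hxS, hx1⟩, rfl⟩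
      rw [mem_smul_set_iff_inv_smul_mem₀ (by positivity)]
      refine ⟨hS.2.2 _ ?_ _ (by positivity), ?_⟩
      · by_cases hx : x ∈ tsupport σ
        · refine hδS (mem_thickening_iff.2 ⟨x, hx, ?_⟩)
          rw [dist_eq_norm, hφ]
          simp only [add_sub_cancel_left]
          rw [norm_smul, Real.norm_of_nonneg ht.le]
          exact (mul_le_mul_of_nonneg_left (hM x) ht.le).trans_lt htM
        · simpa [hφ, image_eq_zero_of_notMem_tsupport hx] using hxS
      · rw [mem_ofPred_eq, hρ.smul_eq _ (by positivity), inv_mul_lt_iff₀ (by positivity), mul_one]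
        calc ρ (φ x) ≤ ρ x + ρ (t • σ x) := hρ.add_le _ _
          _ = ρ x + t * ρ (σ x) := by rw [hρ.smul_eq _ ht.le]
          _ ≤ ρ x + t * 1 := by gcongr; exact hσ1 x
          _ < 1 + t := by rw [mul_one]; exact add_lt_add_left hx1 t
    have hvol : ∫⁻ x in K, ENNReal.ofReal |(1 + t • fderiv ℝ σ x).det| ≤
        ENNReal.ofReal ((1 + t) ^ N * V) := by
      rw [lintegral_abs_det_fderiv_eq_addHaar_image volume hKo.measurableSet hφd hφi]
      refine (measure_mono hφK).trans (le_of_eq ?_)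
      rw [Measure.addHaar_smul_of_nonneg _ (by positivity), finrank_euclideanSpace_fin,
        ENNReal.ofReal_mul (by positivity), hV, ENNReal.ofReal_toReal hKt]
    have hint : IntegrableOn (fun x => 1 + t * vdiv σ x - η * (t * L)) K := by
      refine (Integrable.add ?_ ((integrable_vdiv hσ hσc).integrableOn.const_mul t)).sub ?_
      · exact integrableOn_const hKt
      · exact integrableOn_const hKt
    have hle : ∫ x in K, (1 + t * vdiv σ x - η * (t * L)) ≤ (1 + t) ^ N * V := by
      refine integral_le_of_lintegral_ofReal_le hint (by positivity) (le_trans ?_ hvol)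
      refine lintegral_mono fun x => ENNReal.ofReal_le_ofReal (le_trans ?_ (le_abs_self _))
      have hn : ‖t • fderiv ℝ σ x‖ ≤ t * L := by
        rw [norm_smul, Real.norm_of_nonneg ht.le]
        exact mul_le_mul_of_nonneg_left (hLf x) ht.le
      have h2 := hdet (y := t • fderiv ℝ σ x) (by rw [dist_zero_right]; exact hn.trans_lt htε)
      rw [Real.norm_eq_abs] at h2
      have h3 := (abs_le.1 h2).1
      have h4 : LinearMap.trace ℝ _
          ((t • fderiv ℝ σ x : EuclideanSpace ℝ (Fin N) →L[ℝ] EuclideanSpace ℝ (Fin N)) :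
            EuclideanSpace ℝ (Fin N) →ₗ[ℝ] _) = t * vdiv σ x := by
        rw [vdiv_eq_trace]
        simp
      rw [h4] at h3
      have h5 : η * ‖t • fderiv ℝ σ x‖ ≤ η * (t * L) := by gcongr
      linarith
    have hcalc : ∫ x in K, (1 + t * vdiv σ x - η * (t * L)) = V + t * I - η * (t * L) * V := by
      rw [integral_sub (f := fun x => 1 + t * vdiv σ x), integral_add, integral_const_mul]
      · simp [hV, hI, Measure.real, mul_comm]
      · exact integrableOn_const hKt
      · exact (integrable_vdiv hσ hσc).integrableOn.const_mul t
      · exact (integrableOn_const (C := (1 : ℝ)) hKt).add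
          ((integrable_vdiv hσ hσc).integrableOn.const_mul t)
      · exact integrableOn_const hKt
    rw [hcalc] at hle
    have : t * I ≤ t * (t⁻¹ * ((1 + t) ^ N - 1) * V + η * L * V) := by
      have e : t * (t⁻¹ * ((1 + t) ^ N - 1) * V + η * L * V) =
        ((1 + t) ^ N - 1) * V + η * (t * L) * V := by field_simp
      rw [e]; linarith
    exact le_of_mul_le_mul_left this ht
  have lim : Filter.Tendsto (fun t : ℝ => t⁻¹ * ((1 + t) ^ N - 1)) (𝓝[>] 0) (𝓝 (N : ℝ)) := by
    have := (hasDerivAt_pow N (1 : ℝ)).tendsto_slope_zero_right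
    simpa using this
  have hη : ∀ η > 0, I ≤ N * V + η * (L * V) := by
    intro η hη
    have := ge_of_tendsto ((lim.mul_const V).add_const (η * L * V)) (step η hη)
    linarith
  refine le_of_forall_pos_le_add fun ε hε => ?_
  have hLV : 0 < L * V + 1 := by positivity
  refine (hη (ε / (L * V + 1)) (by positivity)).trans ?_
  gcongr
  rw [div_mul_eq_mul_div, div_le_iff₀ hLV]
  nlinarith

/-- The compactly supported `C¹` vector fields in `S` that are bounded by `1` in the gauge `ρ`. -/
structure IsAdmissible {N : ℕ} (ρ : EuclideanSpace ℝ (Fin N) → ℝ)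
    (S : Set (EuclideanSpace ℝ (Fin N)))
    (σ : EuclideanSpace ℝ (Fin N) → EuclideanSpace ℝ (Fin N)) : Prop where
  contDiff : ContDiff ℝ 1 σ
  hasCompactSupport : HasCompactSupport σ
  tsupport_subset : tsupport σ ⊆ S
  le_one : ∀ x, ρ (σ x) ≤ 1

/-- The total variation of `f` in `S`, measured with the gauge `ρ`, is at most `M`. -/
def HasVariationLE {N : ℕ} (ρ : EuclideanSpace ℝ (Fin N) → ℝ)
    (S : Set (EuclideanSpace ℝ (Fin N))) (f : EuclideanSpace ℝ (Fin N) → ℝ) (M : ℝ) : Prop :=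
  ∀ σ, IsAdmissible ρ S σ → ∫ x, f x * vdiv σ x ≤ M

theorem integral_mul_vdiv {N : ℕ} {w : EuclideanSpace ℝ (Fin N) → ℝ}
    {σ : EuclideanSpace ℝ (Fin N) → EuclideanSpace ℝ (Fin N)} (hw : ContDiff ℝ 1 w)
    (hσ : ContDiff ℝ 1 σ) (hc : HasCompactSupport σ) :
    ∫ x, w x * vdiv σ x = -∫ x, fderiv ℝ w x (σ x) := by
  have hi : ∀ i, ContDiff ℝ 1 fun x => σ x i := fun i => by fun_prop
  have hic : ∀ i, HasCompactSupport fun x => σ x i := fun i =>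
    hc.comp_left (g := fun v : EuclideanSpace ℝ (Fin N) => v i) rfl
  have hd : ∀ i x v, fderiv ℝ σ x v i = fderiv ℝ (fun x => σ x i) x v := by
    intro i x v
    have h1 := (hσ.differentiable one_ne_zero x).hasFDerivAt
    have h2 := (EuclideanSpace.proj (𝕜 := ℝ) i).hasFDerivAt.comp x h1
    have h3 : fderiv ℝ (fun x => σ x i) x = _ := h2.fderiv
    rw [h3]
    rfl
  have hf' : Continuous (fderiv ℝ w) := hw.continuous_fderiv one_ne_zero
  have hg' : ∀ i, Continuous (fderiv ℝ fun x => σ x i) := fun i =>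
    (hi i).continuous_fderiv one_ne_zero
  have hg'c : ∀ i v, HasCompactSupport fun x => fderiv ℝ (fun x => σ x i) x v := fun i v =>
    (hic i).fderiv_apply (𝕜 := ℝ) v
  have int1 : ∀ i v, Integrable fun x => fderiv ℝ w x v * σ x i := fun i v =>
    (Continuous.mul (by fun_prop) (hi i).continuous).integrable_of_hasCompactSupport
      ((hic i).mul_left)
  have int2 : ∀ i v, Integrable fun x => w x * fderiv ℝ (fun x => σ x i) x v := fun i v =>
    (hw.continuous.mul ((hg' i).clm_apply continuous_const)).integrable_of_hasCompactSupport
      ((hg'c i v).mul_left)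
  have key : ∀ i, ∫ x, w x * fderiv ℝ (fun x => σ x i) x (EuclideanSpace.single i 1) =
      -∫ x, fderiv ℝ w x (EuclideanSpace.single i 1) * σ x i := fun i =>
    integral_mul_fderiv_eq_neg_fderiv_mul_of_integrable (int1 i _) (int2 i _)
      ((hw.continuous.mul (hi i).continuous).integrable_of_hasCompactSupport ((hic i).mul_left))
      (fun x _ => hw.differentiable one_ne_zero x) (fun x _ => (hi i).differentiable one_ne_zero x)
  have e1 : ∀ x, w x * vdiv σ x =
      ∑ i, w x * fderiv ℝ (fun x => σ x i) x (EuclideanSpace.single i 1) := by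
    intro x
    simp only [vdiv, Finset.mul_sum, hd]
  have e2 : ∀ x, fderiv ℝ w x (σ x) =
      ∑ i, fderiv ℝ w x (EuclideanSpace.single i 1) * σ x i := by
    intro x
    have : σ x = ∑ i, σ x i • EuclideanSpace.single i (1 : ℝ) := by
      have := (EuclideanSpace.basisFun (Fin N) ℝ).sum_repr (σ x)
      simpa using this.symm
    conv_lhs => rw [this]
    simp [mul_comm]
  simp_rw [e1, e2]
  rw [integral_finsetSum _ fun i _ => int2 i _, integral_finsetSum _ fun i _ => int1 i _,
    ← Finset.sum_neg_distrib]
  exact Finset.sum_congr rfl fun i _ => key i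

theorem sup'_le_softmax_add {ι : Type*} [Fintype ι] [Nonempty ι] (a : ι → ℝ) {β : ℝ}
    (hβ : 0 < β) :
    Finset.univ.sup' Finset.univ_nonempty a ≤
      ∑ i, Real.exp (β * a i) / (∑ j, Real.exp (β * a j)) * a i + Fintype.card ι / β := by
  set A := Finset.univ.sup' Finset.univ_nonempty a with hA
  set Z := ∑ j, Real.exp (β * a j) with hZ
  obtain ⟨i₀, -, hi₀⟩ := Finset.exists_mem_eq_sup' Finset.univ_nonempty a
  have hZA : Real.exp (β * A) ≤ Z := by
    rw [hA, hi₀]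
    exact Finset.single_le_sum (f := fun j => Real.exp (β * a j)) (fun j _ => (Real.exp_pos _).le)
      (Finset.mem_univ i₀)
  have hZ0 : 0 < Z := (Real.exp_pos _).trans_le hZA
  have hsum : ∑ i, Real.exp (β * a i) / Z = 1 := by
    rw [← Finset.sum_div, div_self hZ0.ne']
  have hterm : ∀ i, Real.exp (β * a i) / Z * A ≤ Real.exp (β * a i) / Z * a i + 1 / β := by
    intro i
    have hd : 0 ≤ A - a i := sub_nonneg.2 (Finset.le_sup' a (Finset.mem_univ i))
    have h1 : Real.exp (β * a i) / Z ≤ Real.exp (-(β * (A - a i))) := by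
      rw [div_le_iff₀ hZ0]
      calc Real.exp (β * a i) = Real.exp (-(β * (A - a i))) * Real.exp (β * A) := by
            rw [← Real.exp_add]; ring_nf
        _ ≤ _ := by gcongr
    have h2 : Real.exp (-(β * (A - a i))) * (β * (A - a i)) ≤ 1 := by
      rw [Real.exp_neg, inv_mul_le_iff₀ (Real.exp_pos _), mul_one]
      linarith [Real.add_one_le_exp (β * (A - a i))]
    have h3 : Real.exp (β * a i) / Z * (A - a i) ≤ 1 / β := by
      rw [le_div_iff₀ hβ]
      calc _ = Real.exp (β * a i) / Z * (β * (A - a i)) := by ring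
        _ ≤ Real.exp (-(β * (A - a i))) * (β * (A - a i)) := by gcongr
        _ ≤ 1 := h2
    linarith
  calc A = ∑ i, Real.exp (β * a i) / Z * A := by rw [← Finset.sum_mul, hsum, one_mul]
    _ ≤ ∑ i, (Real.exp (β * a i) / Z * a i + 1 / β) := Finset.sum_le_sum fun i _ => hterm i
    _ = _ := by
      rw [Finset.sum_add_distrib]
      simp [div_eq_mul_inv]

theorem HasVariationLE.integral_mul_sup'_le {N : ℕ} {ρ : EuclideanSpace ℝ (Fin N) → ℝ}
    (hρ : IsGauge ρ) {S : Set (EuclideanSpace ℝ (Fin N))} {w : EuclideanSpace ℝ (Fin N) → ℝ}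
    {M : ℝ} (hM : HasVariationLE ρ S w M) (hw : ContDiff ℝ 2 w) {ι : Type*} [Fintype ι]
    [Nonempty ι] {y : ι → EuclideanSpace ℝ (Fin N)} (hy : ∀ i, ρ (y i) ≤ 1)
    {χ : EuclideanSpace ℝ (Fin N) → ℝ} (hχ : ContDiff ℝ 1 χ) (hχc : HasCompactSupport χ)
    (hχS : tsupport χ ⊆ S) (hχ0 : ∀ x, 0 ≤ χ x) (hχ1 : ∀ x, χ x ≤ 1) :
    ∫ x, χ x * Finset.univ.sup' Finset.univ_nonempty (fun i => -fderiv ℝ w x (y i)) ≤ M := by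
  set a : EuclideanSpace ℝ (Fin N) → ι → ℝ := fun x i => -fderiv ℝ w x (y i) with ha
  have had : ∀ i, ContDiff ℝ 1 fun x => a x i := fun i =>
    ((hw.fderiv_right (m := 1) (by norm_num)).clm_apply contDiff_const).neg
  have hAc : Continuous fun x => Finset.univ.sup' Finset.univ_nonempty (a x) :=
    Continuous.finset_sup'_apply Finset.univ_nonempty fun i _ => (had i).continuous
  have hχi : Integrable χ := hχ.continuous.integrable_of_hasCompactSupport hχc
  have hAi : Integrable fun x => χ x * Finset.univ.sup' Finset.univ_nonempty (a x) :=
    (hχ.continuous.mul hAc).integrable_of_hasCompactSupport hχc.mul_right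
  have step : ∀ β : ℝ, 0 < β → ∫ x, χ x * Finset.univ.sup' Finset.univ_nonempty (a x) ≤
      M + Fintype.card ι / β * ∫ x, χ x := by
    intro β hβ
    set p : EuclideanSpace ℝ (Fin N) → ι → ℝ := fun x i =>
      Real.exp (β * a x i) / ∑ j, Real.exp (β * a x j) with hp
    have hZ : ∀ x, 0 < ∑ j, Real.exp (β * a x j) := fun x =>
      Finset.sum_pos (fun j _ => Real.exp_pos _) Finset.univ_nonempty
    have hpd : ∀ i, ContDiff ℝ 1 fun x => p x i := by
      intro i
      refine ContDiff.div ?_ ?_ fun x => (hZ x).ne'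
      · exact (contDiff_const.mul (had i)).exp
      · exact ContDiff.sum fun j _ => (contDiff_const.mul (had j)).exp
    have hp0 : ∀ x i, 0 ≤ p x i := fun x i => div_nonneg (Real.exp_pos _).le (hZ x).le
    have hps : ∀ x, ∑ i, p x i = 1 := fun x => by
      rw [hp]; simp only; rw [← Finset.sum_div, div_self (hZ x).ne']
    set σ : EuclideanSpace ℝ (Fin N) → EuclideanSpace ℝ (Fin N) :=
      fun x => χ x • ∑ i, p x i • y i with hσ
    have hσd : ContDiff ℝ 1 σ :=
      hχ.smul (ContDiff.sum fun i _ => (hpd i).smul contDiff_const)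
    have hσadm : IsAdmissible ρ S σ := by
      refine ⟨hσd, hχc.smul_right, (tsupport_smul_subset_left χ _).trans hχS, fun x => ?_⟩
      rw [hσ]
      simp only
      rw [hρ.smul_eq _ (hχ0 x)]
      have := hρ.sum_le Finset.univ (p x) y (fun i _ => hp0 x i) (fun i _ => hy i)
      rw [hps] at this
      calc χ x * ρ (∑ i, p x i • y i) ≤ χ x * 1 := by gcongr; exact hχ0 x
        _ ≤ 1 := by rw [mul_one]; exact hχ1 x
    have h1 := hM σ hσadm
    rw [integral_mul_vdiv (hw.of_le (by norm_num)) hσd hσadm.hasCompactSupport,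
      ← integral_neg] at h1
    have e : ∀ x, -fderiv ℝ w x (σ x) = χ x * ∑ i, p x i * a x i := by
      intro x
      simp [hσ, ha, Finset.sum_neg_distrib]
    simp_rw [e] at h1
    have hpi : Integrable fun x => χ x * ∑ i, p x i * a x i :=
      (hχ.continuous.mul (continuous_finsetSum _ fun i _ =>
        (hpd i).continuous.mul (had i).continuous)).integrable_of_hasCompactSupport hχc.mul_right
    calc ∫ x, χ x * Finset.univ.sup' Finset.univ_nonempty (a x)
        ≤ ∫ x, (χ x * ∑ i, p x i * a x i + Fintype.card ι / β * χ x) := by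
          refine integral_mono hAi (hpi.add (hχi.const_mul _)) fun x => ?_
          have := mul_le_mul_of_nonneg_left (sup'_le_softmax_add (a x) hβ) (hχ0 x)
          simp only [hp]
          linarith
      _ = (∫ x, χ x * ∑ i, p x i * a x i) + Fintype.card ι / β * ∫ x, χ x := by
          rw [integral_add hpi (hχi.const_mul _), integral_const_mul]
      _ ≤ _ := by gcongr
  have lim : Filter.Tendsto (fun β : ℝ => M + Fintype.card ι / β * ∫ x, χ x) Filter.atTop
      (𝓝 (M + 0 * ∫ x, χ x)) :=
    ((tendsto_const_nhds.div_atTop Filter.tendsto_id).mul_const _).const_add _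
  rw [zero_mul, add_zero] at lim
  exact ge_of_tendsto lim ((Filter.eventually_gt_atTop 0).mono step)

theorem IsCompact.exists_contDiff_cutoff {N : ℕ} {Q S : Set (EuclideanSpace ℝ (Fin N))}
    (hQ : IsCompact Q) (hS : IsOpen S) (hQS : Q ⊆ S) :
    ∃ χ : EuclideanSpace ℝ (Fin N) → ℝ, ContDiff ℝ 1 χ ∧ HasCompactSupport χ ∧
      tsupport χ ⊆ S ∧ (∀ x, 0 ≤ χ x) ∧ (∀ x, χ x ≤ 1) ∧ ∀ x ∈ Q, χ x = 1 := by
  obtain ⟨L, hL, hQL, hLS⟩ := exists_compact_between hQ hS hQS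
  obtain ⟨χ, hχ, hr, hs, h1⟩ := exists_contMDiff_support_eq_eq_one_iff (n := 1)
    (modelWithCornersSelf ℝ (EuclideanSpace ℝ (Fin N))) isOpen_interior hQ.isClosed hQL
  have ht : tsupport χ ⊆ L := closure_minimal (hs.subset.trans interior_subset) hL.isClosed
  exact ⟨χ, hχ.contDiff, HasCompactSupport.of_support_subset_isCompact hL
    (hs.subset.trans interior_subset), ht.trans hLS, fun x => (hr (mem_range_self x)).1,
    fun x => (hr (mem_range_self x)).2, fun x hx => (h1 x).1 hx⟩

theorem HasVariationLE.setLIntegral_sup'_le {N : ℕ} {ρ : EuclideanSpace ℝ (Fin N) → ℝ}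
    (hρ : IsGauge ρ) {S : Set (EuclideanSpace ℝ (Fin N))} (hS : IsOpen S)
    {w : EuclideanSpace ℝ (Fin N) → ℝ}
    {M : ℝ} (hM : HasVariationLE ρ S w M) (hw : ContDiff ℝ 2 w) {ι : Type*} [Fintype ι]
    [Nonempty ι] {y : ι → EuclideanSpace ℝ (Fin N)} (hy : ∀ i, ρ (y i) ≤ 1)
    (hy0 : ∃ i, y i = 0) :
    ∫⁻ x in S, ENNReal.ofReal
      (Finset.univ.sup' Finset.univ_nonempty (fun i => -fderiv ℝ w x (y i))) ≤
      ENNReal.ofReal M := by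
  set A : EuclideanSpace ℝ (Fin N) → ℝ := fun x =>
    Finset.univ.sup' Finset.univ_nonempty (fun i => -fderiv ℝ w x (y i)) with hA
  have hAc : Continuous A := by
    have := hw.continuous_fderiv two_ne_zero
    exact Continuous.finset_sup'_apply Finset.univ_nonempty fun i _ => by fun_prop
  have hA0 : ∀ x, 0 ≤ A x := by
    intro x
    obtain ⟨i, hi⟩ := hy0
    refine le_trans ?_ (Finset.le_sup' (fun i => -fderiv ℝ w x (y i)) (Finset.mem_univ i))
    simp [hi]
  have : IsLocallyFiniteMeasure (volume.withDensity fun x => ENNReal.ofReal (A x)) :=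
    .withDensity_ofReal hAc
  rw [← withDensity_apply _ hS.measurableSet, hS.measure_eq_iSup_isCompact]
  refine iSup_le fun Q => iSup_le fun hQS => iSup_le fun hQ => ?_
  rw [withDensity_apply _ hQ.measurableSet]
  obtain ⟨χ, hχ, hχc, hχS, hχ0, hχ1, hχQ⟩ := hQ.exists_contDiff_cutoff hS hQS
  have hi : Integrable fun x => χ x * A x :=
    (hχ.continuous.mul hAc).integrable_of_hasCompactSupport hχc.mul_right
  calc ∫⁻ x in Q, ENNReal.ofReal (A x) = ∫⁻ x in Q, ENNReal.ofReal (χ x * A x) :=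
        setLIntegral_congr_fun hQ.measurableSet fun x hx => by simp only [hχQ x hx, one_mul]
    _ ≤ ∫⁻ x, ENNReal.ofReal (χ x * A x) := setLIntegral_le_lintegral _ _
    _ = ENNReal.ofReal (∫ x, χ x * A x) :=
        (ofReal_integral_eq_lintegral_ofReal hi
          (Filter.Eventually.of_forall fun x => mul_nonneg (hχ0 x) (hA0 x))).symm
    _ ≤ _ := ENNReal.ofReal_le_ofReal (hM.integral_mul_sup'_le hρ hw hy hχ hχc hχS hχ0 hχ1)

theorem IsOpenConvexCone.add_smul_mem {N : ℕ} {S : Set (EuclideanSpace ℝ (Fin N))}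
    (hS : IsOpenConvexCone S) {x y : EuclideanSpace ℝ (Fin N)} (hx : x ∈ S) (hy : y ∈ S) {t : ℝ}
    (ht : 0 < t) : x + t • y ∈ S := by
  have h1 : (1 / 2 : ℝ) • x + (1 / 2 : ℝ) • t • y ∈ S :=
    hS.2.1 hx (hS.2.2 y hy t ht) (by norm_num) (by norm_num) (by norm_num)
  have h2 := hS.2.2 _ h1 2 two_pos
  rwa [← smul_add, smul_smul, mul_one_div_cancel two_ne_zero, one_smul] at h2

/-- A second-order Taylor bound for a compactly supported `C²` function. -/
theorem exists_taylor_bound {N : ℕ} {w : EuclideanSpace ℝ (Fin N) → ℝ} (hw : ContDiff ℝ 2 w)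
    (hwc : HasCompactSupport w) :
    ∃ C L : ℝ, 0 ≤ C ∧ 0 ≤ L ∧ (∀ x, ‖fderiv ℝ w x‖ ≤ C) ∧
      ∀ x v, w (x - v) ≤ w x - fderiv ℝ w x v + L * ‖v‖ ^ 2 := by
  have hd : ContDiff ℝ 1 (fderiv ℝ w) := hw.fderiv_right (by norm_num)
  obtain ⟨C, hC⟩ := (hwc.fderiv (𝕜 := ℝ)).exists_bound_of_continuous hd.continuous
  obtain ⟨L, hL⟩ := hd.lipschitzWith_of_hasCompactSupport (hwc.fderiv (𝕜 := ℝ)) one_ne_zero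
  refine ⟨C, L, (norm_nonneg _).trans (hC 0), L.2, hC, fun x v => ?_⟩
  have hLip : ∀ z, ‖fderiv ℝ w z - fderiv ℝ w x‖ ≤ L * ‖z - x‖ := fun z =>
    hL.norm_sub_le z x
  have h := Convex.norm_image_sub_le_of_norm_fderiv_le' (𝕜 := ℝ) (f := w) (φ := fderiv ℝ w x)
    (s := closedBall x ‖v‖) (C := L * ‖v‖) (x := x) (y := x - v)
    (fun z _ => hw.differentiable two_ne_zero z)
    (fun z hz => (hLip z).trans (by
      rw [mem_closedBall_iff_norm] at hz
      gcongr))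
    (convex_closedBall _ _) (mem_closedBall_self (norm_nonneg _))
    (by rw [mem_closedBall_iff_norm]; simp)
  have e : x - v - x = -v := by abel
  rw [e, norm_neg, map_neg, Real.norm_eq_abs] at h
  have := (abs_le.1 h).2
  linarith

theorem HasVariationLE.mul_volume_superlevel_le {N : ℕ} (hN : 2 ≤ N)
    {ρ : EuclideanSpace ℝ (Fin N) → ℝ}
    (hρ : IsGauge ρ) {S : Set (EuclideanSpace ℝ (Fin N))} (hS : IsOpenConvexCone S)
    (hK0 : volume (S ∩ {y | ρ y < 1}) ≠ 0) {w : EuclideanSpace ℝ (Fin N) → ℝ}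
    {M : ℝ} (hM : HasVariationLE ρ S w M) (hw : ContDiff ℝ 2 w) (hwc : HasCompactSupport w)
    (hw0 : ∀ x, 0 ≤ w x) (s₀ : ℝ) :
    ENNReal.ofReal (N * s₀) * volume (S ∩ {y | ρ y < 1}) ^ (1 / N : ℝ) *
      volume (S ∩ {x | s₀ < w x}) ^ (((N : ℝ) - 1) / N) ≤ ENNReal.ofReal M := by
  set K := S ∩ {y | ρ y < 1} with hK
  have hKo : IsOpen K := hS.1.inter (hρ.isOpen_ball 1)
  have hKb : Bornology.IsBounded K := (hρ.isBounded_ball 1).subset inter_subset_right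
  obtain ⟨R, hR0, hR⟩ := hKb.exists_pos_norm_le
  obtain ⟨C, L, hC, hL, hwC, hwT⟩ := exists_taylor_bound hw hwc
  have hp : 0 < ((N : ℝ) - 1) / N := by
    have : (2 : ℝ) ≤ N := by exact_mod_cast hN
    exact div_pos (by linarith) (by linarith)
  set p := ((N : ℝ) - 1) / N with hpdef
  set F : ℝ → Set (EuclideanSpace ℝ (Fin N)) := fun s => S ∩ {x | s < w x} with hF
  have hFm : ∀ s, MeasurableSet (F s) := fun s =>
    (hS.1.inter (isOpen_lt continuous_const hw.continuous)).measurableSet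
  have hFsupp : ∀ s, 0 ≤ s → F s ⊆ tsupport w := fun s hs x hx =>
    subset_tsupport w (hs.trans_lt hx.2).ne'
  have hFb : ∀ s, 0 ≤ s → Bornology.IsBounded (F s) := fun s hs =>
    hwc.isCompact.isBounded.subset (hFsupp s hs)
  set D := thickening (R + 1) (tsupport w) with hD
  have hDo : IsOpen D := isOpen_thickening
  have hDv : volume (S ∩ D) ≠ ⊤ :=
    ((hwc.isCompact.isBounded.thickening (δ := R + 1)).subset inter_subset_right).measure_lt_top.ne
  have step : ∀ t : ℝ, 0 < t → t ≤ 1 →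
      ENNReal.ofReal (N * s₀) * volume K ^ (1 / N : ℝ) * volume (F s₀) ^ p ≤
        ENNReal.ofReal M + ENNReal.ofReal (t * (C + L * R ^ 2)) * volume (S ∩ D) := by
    intro t ht ht1
    obtain ⟨Y, hYK, hYf, hYc⟩ := Metric.finite_approx_of_totallyBounded
      (hKb.isCompact_closure.totallyBounded.subset subset_closure) t ht
    let ι := {y : EuclideanSpace ℝ (Fin N) // y ∈ insert 0 Y}
    have : Finite ι := (hYf.insert 0).to_subtype
    have : Fintype ι := Fintype.ofFinite _
    have : Nonempty ι := ⟨⟨0, mem_insert _ _⟩⟩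
    set A : EuclideanSpace ℝ (Fin N) → ℝ := fun x =>
      Finset.univ.sup' Finset.univ_nonempty (fun i : ι => -fderiv ℝ w x i) with hA
    have hAc : Continuous A := by
      have := hw.continuous_fderiv two_ne_zero
      exact Continuous.finset_sup'_apply Finset.univ_nonempty fun i _ => (this.clm_apply continuous_const).neg
    have hA0 : ∀ x, 0 ≤ A x := by
      intro x
      refine le_trans ?_ (Finset.le_sup' (fun i : ι => -fderiv ℝ w x i)
        (Finset.mem_univ ⟨0, mem_insert _ _⟩))
      simp
    have hAM : ∫⁻ x in S, ENNReal.ofReal (A x) ≤ ENNReal.ofReal M := by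
      refine hM.setLIntegral_sup'_le hρ hS.1 hw (y := fun i : ι => i.1)
        ?_ ⟨⟨0, mem_insert _ _⟩, rfl⟩
      rintro ⟨y, rfl | hy⟩
      · simp [hρ.map_zero]
      · exact (hYK hy).2.le
    have hAK : ∀ x, ∀ y ∈ K, -fderiv ℝ w x y ≤ A x + C * t := by
      intro x y hy
      obtain ⟨z, hz, hyz⟩ := mem_iUnion₂.1 (hYc hy)
      have h1 : -fderiv ℝ w x z ≤ A x :=
        Finset.le_sup' (fun i : ι => -fderiv ℝ w x i) (Finset.mem_univ ⟨z, mem_insert_of_mem _ hz⟩)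
      have h2 : ‖fderiv ℝ w x (z - y)‖ ≤ C * t := by
        refine (ContinuousLinearMap.le_opNorm _ _).trans ?_
        rw [mem_ball, dist_comm, dist_eq_norm] at hyz
        exact mul_le_mul (hwC x) hyz.le (norm_nonneg _) hC
      have h3 := (le_abs_self _).trans h2
      rw [map_sub] at h3
      linarith
    set B : EuclideanSpace ℝ (Fin N) → ℝ := fun x => A x + t * (C + L * R ^ 2) with hB
    have hB0 : ∀ x, 0 ≤ B x := fun x => add_nonneg (hA0 x) (by positivity)
    set G : EuclideanSpace ℝ (Fin N) → ℝ := fun x => w x + D.indicator (fun x => t * B x) x with hG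
    have hBc : Continuous B := hAc.add continuous_const
    have hI0 : ∀ x, 0 ≤ D.indicator (fun x => t * B x) x := fun x =>
      indicator_nonneg (fun x _ => mul_nonneg ht.le (hB0 x)) x
    have hIm : Measurable (D.indicator fun x => t * B x) :=
      (hBc.const_mul t |>.measurable).indicator hDo.measurableSet
    have hGm : Measurable G := hw.continuous.measurable.add hIm
    have hBM : ∀ s : ℝ, 0 ≤ s → volume (F s) +
        ENNReal.ofReal (N * t) * volume K ^ (1 / N : ℝ) * volume (F s) ^ p ≤
          volume (S ∩ {x | s < G x}) := by
      intro s hs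
      by_cases h0 : volume (F s) = 0
      · rw [h0, ENNReal.zero_rpow_of_pos hp]
        simp
      refine volume_add_le_volume_minkowski (by omega) (hFm s) hKo.measurableSet
        (hS.1.measurableSet.inter (measurableSet_lt measurable_const hGm)) (hFb s hs) hKb ht h0
        hK0 ?_
      intro x hx y hy
      refine ⟨hS.add_smul_mem hx.1 hy.1 ht, ?_⟩
      have hxw : s < w x := hx.2
      have hty : ‖t • y‖ ≤ t * R := by
        rw [norm_smul, Real.norm_of_nonneg ht.le]
        exact mul_le_mul_of_nonneg_left (hR y hy) ht.le
      have hxD : x + t • y ∈ D := by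
        refine mem_thickening_iff.2 ⟨x, hFsupp s hs hx, ?_⟩
        rw [dist_eq_norm, add_sub_cancel_left]
        nlinarith
      rw [mem_ofPred_eq, hG]
      simp only [indicator_of_mem hxD]
      have h1 := hwT (x + t • y) (t • y)
      rw [add_sub_cancel_right, map_smul, smul_eq_mul] at h1
      have h2 := mul_le_mul_of_nonneg_left (hAK (x + t • y) y hy) ht.le
      have h3 : L * ‖t • y‖ ^ 2 ≤ L * (t * R) ^ 2 := by gcongr
      simp only [hB]
      nlinarith
    have hlayer : ∀ f : EuclideanSpace ℝ (Fin N) → ℝ, Measurable f → (∀ x, 0 ≤ f x) →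
        ∫⁻ x in S, ENNReal.ofReal (f x) = ∫⁻ s in Ioi (0 : ℝ), volume (S ∩ {x | s < f x}) := by
      intro f hf hf0
      rw [lintegral_eq_lintegral_meas_lt _ (Filter.Eventually.of_forall hf0) hf.aemeasurable]
      refine lintegral_congr fun s => ?_
      rw [Measure.restrict_apply (measurableSet_lt measurable_const hf), inter_comm]
    have hFanti : Antitone fun s => volume (F s) := fun a b hab =>
      measure_mono (inter_subset_inter_right _ fun x (hx : b < w x) => hab.trans_lt hx)
    have hwint : ∫⁻ x in S, ENNReal.ofReal (w x) ≠ ⊤ := by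
      have h1 : Integrable w := hw.continuous.integrable_of_hasCompactSupport hwc
      exact (h1.restrict (s := S)).lintegral_lt_top.ne
    have hFint : ENNReal.ofReal s₀ * volume (F s₀) ^ p ≤
        ∫⁻ s in Ioi (0 : ℝ), volume (F s) ^ p := by
      calc ENNReal.ofReal s₀ * volume (F s₀) ^ p
          = ∫⁻ s in Ioc 0 s₀, volume (F s₀) ^ p := by
            rw [setLIntegral_const, Real.volume_Ioc, sub_zero, mul_comm]
        _ ≤ ∫⁻ s in Ioc 0 s₀, volume (F s) ^ p :=
            setLIntegral_mono' measurableSet_Ioc fun s hs =>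
              ENNReal.rpow_le_rpow (hFanti hs.2) hp.le
        _ ≤ _ := lintegral_mono_set Ioc_subset_Ioi_self
    have hmain : (∫⁻ x in S, ENNReal.ofReal (w x)) + ENNReal.ofReal (N * t) *
        volume K ^ (1 / N : ℝ) * (ENNReal.ofReal s₀ * volume (F s₀) ^ p) ≤
        (∫⁻ x in S, ENNReal.ofReal (w x)) + ∫⁻ x in S ∩ D, ENNReal.ofReal (t * B x) := by
      calc _ ≤ (∫⁻ s in Ioi (0 : ℝ), volume (F s)) + ENNReal.ofReal (N * t) *
            volume K ^ (1 / N : ℝ) * ∫⁻ s in Ioi (0 : ℝ), volume (F s) ^ p := by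
            rw [hlayer w hw.continuous.measurable hw0]
            gcongr
        _ = ∫⁻ s in Ioi (0 : ℝ), (volume (F s) +
              ENNReal.ofReal (N * t) * volume K ^ (1 / N : ℝ) * volume (F s) ^ p) := by
            rw [lintegral_add_left hFanti.measurable, lintegral_const_mul]
            exact hFanti.measurable.pow_const p
        _ ≤ ∫⁻ s in Ioi (0 : ℝ), volume (S ∩ {x | s < G x}) :=
            setLIntegral_mono' measurableSet_Ioi fun s hs => hBM s (le_of_lt hs)
        _ = ∫⁻ x in S, ENNReal.ofReal (G x) :=
            (hlayer G hGm fun x => add_nonneg (hw0 x) (hI0 x)).symm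
        _ = (∫⁻ x in S, ENNReal.ofReal (w x)) +
              ∫⁻ x in S, ENNReal.ofReal (D.indicator (fun x => t * B x) x) := by
            rw [← lintegral_add_left hw.continuous.measurable.ennreal_ofReal]
            exact lintegral_congr fun x => ENNReal.ofReal_add (hw0 x) (hI0 x)
        _ = _ := by
            congr 1
            rw [inter_comm, ← setLIntegral_indicator hDo.measurableSet]
            refine lintegral_congr fun x => ?_
            by_cases hx : x ∈ D <;> simp [hx]
    have hmain2 := (ENNReal.add_le_add_iff_left hwint).1 hmain
    have hBint : ∫⁻ x in S ∩ D, ENNReal.ofReal (t * B x) ≤ ENNReal.ofReal t *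
        (ENNReal.ofReal M + ENNReal.ofReal (t * (C + L * R ^ 2)) * volume (S ∩ D)) := by
      calc ∫⁻ x in S ∩ D, ENNReal.ofReal (t * B x)
          = ENNReal.ofReal t * ∫⁻ x in S ∩ D, (ENNReal.ofReal (A x) +
              ENNReal.ofReal (t * (C + L * R ^ 2))) := by
            rw [← lintegral_const_mul _ (by fun_prop)]
            refine lintegral_congr fun x => ?_
            rw [ENNReal.ofReal_mul ht.le, ENNReal.ofReal_add (hA0 x) (by positivity)]
        _ = ENNReal.ofReal t * ((∫⁻ x in S ∩ D, ENNReal.ofReal (A x)) +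
              ENNReal.ofReal (t * (C + L * R ^ 2)) * volume (S ∩ D)) := by
            rw [lintegral_add_left hAc.measurable.ennreal_ofReal, setLIntegral_const]
        _ ≤ _ := by
            gcongr
            exact (lintegral_mono_set inter_subset_left).trans hAM
    have ht0 : ENNReal.ofReal t ≠ 0 := by simpa using ht
    refine (ENNReal.mul_le_mul_iff_right ht0 ENNReal.ofReal_ne_top).1
      (le_trans (le_of_eq ?_) (hmain2.trans hBint))
    rw [ENNReal.ofReal_mul (by positivity), ENNReal.ofReal_mul (by positivity)]
    ring
  have lim : Filter.Tendsto (fun t : ℝ => ENNReal.ofReal M +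
      ENNReal.ofReal (t * (C + L * R ^ 2)) * volume (S ∩ D)) (𝓝[>] 0)
      (𝓝 (ENNReal.ofReal M + ENNReal.ofReal (0 * (C + L * R ^ 2)) * volume (S ∩ D))) := by
    refine Filter.Tendsto.mono_left ?_ nhdsWithin_le_nhds
    refine tendsto_const_nhds.add (ENNReal.Tendsto.mul_const ?_ (Or.inr hDv))
    exact (ENNReal.continuous_ofReal.comp (continuous_id.mul continuous_const)).tendsto 0
  rw [zero_mul, ENNReal.ofReal_zero, zero_mul, add_zero] at lim
  refine ge_of_tendsto lim ?_
  filter_upwards [self_mem_nhdsWithin, mem_nhdsWithin_of_mem_nhds (Iic_mem_nhds one_pos)]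
    with t ht ht1 using step t ht ht1

theorem vdiv_comp_sub {N : ℕ} (σ : EuclideanSpace ℝ (Fin N) → EuclideanSpace ℝ (Fin N))
    (a x : EuclideanSpace ℝ (Fin N)) : vdiv (fun x => σ (x - a)) x = vdiv σ (x - a) := by
  simp only [vdiv, fderiv_comp_sub]

theorem vdiv_smul {N : ℕ} {σ : EuclideanSpace ℝ (Fin N) → EuclideanSpace ℝ (Fin N)}
    {χ : EuclideanSpace ℝ (Fin N) → ℝ} {x : EuclideanSpace ℝ (Fin N)}
    (hσ : DifferentiableAt ℝ σ x) (hχ : DifferentiableAt ℝ χ x) :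
    vdiv (fun x => χ x • σ x) x = χ x * vdiv σ x + fderiv ℝ χ x (σ x) := by
  have e : fderiv ℝ χ x (σ x) = ∑ i, fderiv ℝ χ x (EuclideanSpace.single i 1) * σ x i := by
    have h := (EuclideanSpace.basisFun (Fin N) ℝ).sum_repr (σ x)
    have : σ x = ∑ i, σ x i • EuclideanSpace.single i (1 : ℝ) := by simpa using h.symm
    conv_lhs => rw [this]
    simp [mul_comm]
  rw [vdiv, fderiv_fun_smul hχ hσ, e, vdiv, Finset.mul_sum, ← Finset.sum_add_distrib]
  simp

/-- Translating an admissible field by a vector of the cone keeps it admissible. -/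
theorem IsAdmissible.comp_sub {N : ℕ} {ρ : EuclideanSpace ℝ (Fin N) → ℝ}
    {S : Set (EuclideanSpace ℝ (Fin N))} (hS : IsOpenConvexCone S)
    {σ : EuclideanSpace ℝ (Fin N) → EuclideanSpace ℝ (Fin N)} (hσ : IsAdmissible ρ S σ)
    {b : EuclideanSpace ℝ (Fin N)} (hb : b ∈ S) : IsAdmissible ρ S fun x => σ (x - b) := by
  refine ⟨hσ.contDiff.comp (contDiff_id.sub contDiff_const),
    hσ.hasCompactSupport.comp_homeomorph (Homeomorph.subRight b), ?_, fun x => hσ.le_one _⟩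
  have h := tsupport_comp_eq_preimage σ (Homeomorph.subRight b)
  intro x hx
  have hx' : x - b ∈ tsupport σ := by
    have : x ∈ tsupport (σ ∘ Homeomorph.subRight b) := hx
    rwa [h] at this
  have := hS.add_smul_mem (hσ.tsupport_subset hx') hb one_pos
  rwa [one_smul, sub_add_cancel] at this

theorem HasVariationLE.convolution_comp_add {N : ℕ} {ρ : EuclideanSpace ℝ (Fin N) → ℝ}
    {S : Set (EuclideanSpace ℝ (Fin N))} (hS : IsOpenConvexCone S)
    {f : EuclideanSpace ℝ (Fin N) → ℝ} {M : ℝ} (hM : HasVariationLE ρ S f M)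
    (hf : Integrable f) {φ : ContDiffBump (0 : EuclideanSpace ℝ (Fin N))}
    {a : EuclideanSpace ℝ (Fin N)} (ha : ball a φ.rOut ⊆ S) :
    HasVariationLE ρ S
      (fun x => convolution (φ.normed volume) f (ContinuousLinearMap.lsmul ℝ ℝ) volume (x + a))
      M := by
  intro τ hτ
  set g := φ.normed (volume : Measure (EuclideanSpace ℝ (Fin N))) with hg
  have hgi : Integrable g := φ.integrable_normed
  set v : EuclideanSpace ℝ (Fin N) → ℝ := fun x => vdiv τ (x - a) with hv
  have hvc : Continuous v := (continuous_vdiv hτ.contDiff).comp (continuous_id.sub continuous_const)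
  obtain ⟨B, hB⟩ := (hasCompactSupport_vdiv hτ.hasCompactSupport).exists_bound_of_continuous
    (continuous_vdiv hτ.contDiff)
  have hint : Integrable (Function.uncurry fun x z => g z * f (x - z) * v x)
      ((volume : Measure (EuclideanSpace ℝ (Fin N))).prod volume) := by
    have h1 := Integrable.convolution_integrand (ContinuousLinearMap.lsmul ℝ ℝ) hgi hf
    refine h1.mul_bdd (c := B) (hvc.comp continuous_fst).aestronglyMeasurable ?_
    exact Filter.Eventually.of_forall fun p => hB _
  have e1 : ∫ x, convolution g f (ContinuousLinearMap.lsmul ℝ ℝ) volume (x + a) * vdiv τ x =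
      ∫ x, ∫ z, g z * f (x - z) * v x := by
    rw [← integral_add_right_eq_self (fun x => ∫ z, g z * f (x - z) * v x) a]
    refine integral_congr_ae (Filter.Eventually.of_forall fun x => ?_)
    simp only [hv, add_sub_cancel_right, convolution_def, ContinuousLinearMap.lsmul_apply,
      smul_eq_mul]
    rw [integral_mul_const]
  rw [e1, integral_integral_swap hint]
  have hz : ∀ z, ∫ x, g z * f (x - z) * v x ≤ g z * M := by
    intro z
    by_cases h0 : g z = 0
    · simp [h0]
    have hzb : z ∈ ball 0 φ.rOut := by
      rw [← φ.support_normed_eq (μ := volume)]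
      exact h0
    have hb : a - z ∈ S := ha (by
      rw [mem_ball_iff_norm] at hzb ⊢
      simpa using hzb)
    have e2 : ∫ x, g z * f (x - z) * v x = g z * ∫ u, f u * vdiv (fun x => τ (x - (a - z))) u := by
      rw [← integral_sub_right_eq_self (fun u => f u * vdiv (fun x => τ (x - (a - z))) u) z,
        ← integral_const_mul]
      refine integral_congr_ae (Filter.Eventually.of_forall fun x => ?_)
      simp only [hv, vdiv_comp_sub]
      rw [show x - z - (a - z) = x - a by abel, mul_assoc]
    rw [e2]
    exact mul_le_mul_of_nonneg_left (hM _ (hτ.comp_sub hS hb)) (φ.nonneg_normed z)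
  calc ∫ z, ∫ x, g z * f (x - z) * v x ≤ ∫ z, g z * M :=
        integral_mono hint.integral_prod_right (hgi.mul_const M) hz
    _ = M := by rw [integral_mul_const, hg, φ.integral_normed, one_mul]

theorem HasVariationLE.indicator_cutoff {N : ℕ} {ρ : EuclideanSpace ℝ (Fin N) → ℝ}
    (hρ : IsGauge ρ) {S E : Set (EuclideanSpace ℝ (Fin N))} (hS : IsOpen S) (hE : MeasurableSet E)
    (hEfin : volume (S ∩ E) ≠ ⊤) {M : ℝ} (hM : HasVariationLE ρ S (E.indicator 1) M) {c : ℝ}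
    (hc : 0 < c) (hcρ : ∀ x, c * ‖x‖ ≤ ρ x) {χ : EuclideanSpace ℝ (Fin N) → ℝ}
    (hχ : ContDiff ℝ 1 χ) (hχ0 : ∀ x, 0 ≤ χ x) (hχ1 : ∀ x, χ x ≤ 1) {ε : ℝ}
    (hχε : ∀ x, ‖fderiv ℝ χ x‖ ≤ ε) :
    HasVariationLE ρ S ((S ∩ E).indicator χ) (M + ε * c⁻¹ * (volume (S ∩ E)).toReal) := by
  intro σ hσ
  have hm : MeasurableSet (S ∩ E) := hS.measurableSet.inter hE
  have hadm : IsAdmissible ρ S fun x => χ x • σ x := by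
    refine ⟨hχ.smul hσ.contDiff, hσ.hasCompactSupport.mono' ?_,
      (closure_mono ?_).trans hσ.tsupport_subset, fun x => ?_⟩
    · exact (Function.support_smul_subset_right χ σ).trans (subset_tsupport σ)
    · exact Function.support_smul_subset_right χ σ
    rw [hρ.smul_eq _ (hχ0 x)]
    calc χ x * ρ (σ x) ≤ χ x * 1 := mul_le_mul_of_nonneg_left (hσ.le_one x) (hχ0 x)
      _ ≤ 1 := by rw [mul_one]; exact hχ1 x
  have hσn : ∀ x, ‖σ x‖ ≤ c⁻¹ := fun x => by
    rw [← one_div, le_div_iff₀ hc, mul_comm]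
    exact (hcρ _).trans (hσ.le_one x)
  have h1 : ∫ x in S ∩ E, vdiv (fun x => χ x • σ x) x ≤ M := by
    rw [← setIntegral_vdiv_inter hS.measurableSet hadm.tsupport_subset, ← integral_indicator hE]
    refine (integral_congr_ae (Filter.Eventually.of_forall fun x => ?_)).trans_le (hM _ hadm)
    by_cases hx : x ∈ E <;> simp [hx]
  have hgc : Continuous fun x => fderiv ℝ χ x (σ x) :=
    (hχ.continuous_fderiv one_ne_zero).clm_apply hσ.contDiff.continuous
  have hgi : Integrable fun x => fderiv ℝ χ x (σ x) :=
    hgc.integrable_of_hasCompactSupport (HasCompactSupport.intro hσ.hasCompactSupport fun x hx => by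
      rw [image_eq_zero_of_notMem_tsupport hx, map_zero])
  have e : ∫ x, (S ∩ E).indicator χ x * vdiv σ x =
      (∫ x in S ∩ E, vdiv (fun x => χ x • σ x) x) - ∫ x in S ∩ E, fderiv ℝ χ x (σ x) := by
    rw [← integral_sub (integrable_vdiv hadm.contDiff hadm.hasCompactSupport).integrableOn
      hgi.integrableOn, ← integral_indicator hm]
    refine integral_congr_ae (Filter.Eventually.of_forall fun x => ?_)
    have := vdiv_smul (hσ.contDiff.differentiable one_ne_zero x)
      (hχ.differentiable one_ne_zero x)
    by_cases hx : x ∈ S ∩ E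
    · simp only [indicator_of_mem hx, this, add_sub_cancel_right]
    · simp only [indicator_of_notMem hx, zero_mul]
  have h2 : ‖∫ x in S ∩ E, fderiv ℝ χ x (σ x)‖ ≤ ε * c⁻¹ * (volume (S ∩ E)).toReal := by
    refine norm_setIntegral_le_of_norm_le_const (lt_top_iff_ne_top.2 hEfin) fun x _ => ?_
    refine (ContinuousLinearMap.le_opNorm _ _).trans ?_
    exact mul_le_mul (hχε x) (hσn x) (norm_nonneg _) ((norm_nonneg _).trans (hχε x))
  rw [e]
  have := (abs_le.1 h2).1
  linarith

theorem exists_cutoff_sequence {N : ℕ} : ∃ (χ : ℕ → EuclideanSpace ℝ (Fin N) → ℝ) (C : ℝ),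
    ∀ n, ContDiff ℝ 1 (χ n) ∧ HasCompactSupport (χ n) ∧ (∀ x, 0 ≤ χ n x) ∧ (∀ x, χ n x ≤ 1) ∧
      (∀ x, ‖x‖ ≤ n + 1 → χ n x = 1) ∧ ∀ x, ‖fderiv ℝ (χ n) x‖ ≤ C / (n + 1) := by
  let ψ : ContDiffBump (0 : EuclideanSpace ℝ (Fin N)) := ⟨1, 2, one_pos, one_lt_two⟩
  have hψ : ContDiff ℝ 1 ψ := ψ.contDiff
  obtain ⟨C, hC⟩ := (ψ.hasCompactSupport.fderiv (𝕜 := ℝ)).exists_bound_of_continuous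
    (hψ.continuous_fderiv one_ne_zero)
  refine ⟨fun n x => ψ (((n : ℝ) + 1)⁻¹ • x), C, fun n => ?_⟩
  have hn : (0 : ℝ) < n + 1 := by positivity
  refine ⟨hψ.comp (contDiff_const_smul _), ?_, fun x => ψ.nonneg, fun x => ψ.le_one, fun x hx => ?_,
    fun x => ?_⟩
  · exact ψ.hasCompactSupport.comp_smul (inv_ne_zero hn.ne')
  · refine ψ.one_of_mem_closedBall ?_
    rw [mem_closedBall_zero_iff, norm_smul, norm_inv, Real.norm_of_nonneg hn.le]
    exact (inv_mul_le_iff₀ hn).2 (by simpa [ψ] using hx)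
  · rw [fderiv_comp_smul, norm_smul, norm_inv, Real.norm_of_nonneg hn.le, div_eq_inv_mul]
    gcongr
    exact hC _

theorem mul_measure_rpow_le_of_eventually_mem {α : Type*} [MeasurableSpace α] {μ : Measure α}
    {A : Set α} {B : ℕ → Set α}
    (hA : ∀ᵐ x ∂μ, x ∈ A → ∀ᶠ n in Filter.atTop, x ∈ B n) {c : ℝ≥0∞} (hc : c ≠ ⊤) {p : ℝ}
    (hp : 0 ≤ p) {b : ℕ → ℝ≥0∞} {l : ℝ≥0∞} (hb : Filter.Tendsto b Filter.atTop (𝓝 l))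
    (h : ∀ n, c * μ (B n) ^ p ≤ b n) : c * μ A ^ p ≤ l := by
  set D : ℕ → Set α := fun n => ⋂ m ≥ n, B m with hD
  have hDm : Monotone D := fun i j hij =>
    biInter_subset_biInter_left fun m (hm : j ≤ m) => hij.trans hm
  have hle : μ A ≤ μ (⋃ n, D n) := measure_mono_ae (by
    filter_upwards [hA] with x hx hxA
    obtain ⟨n, hn⟩ := Filter.eventually_atTop.1 (hx hxA)
    exact mem_iUnion.2 ⟨n, mem_iInter₂.2 hn⟩)
  have lim := ENNReal.Tendsto.const_mul (a := c)
    ((tendsto_measure_iUnion_atTop (μ := μ) hDm).ennrpow_const p) (Or.inr hc)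
  refine (mul_le_mul_right (ENNReal.rpow_le_rpow hle hp) c).trans
    (le_of_tendsto_of_tendsto' lim hb fun n => ?_)
  refine le_trans ?_ (h n)
  gcongr
  exact measure_mono (biInter_subset_of_mem (Set.mem_Ici.2 le_rfl))

theorem HasVariationLE.mul_volume_translate_superlevel_le {N : ℕ} (hN : 2 ≤ N)
    {ρ : EuclideanSpace ℝ (Fin N) → ℝ}
    (hρ : IsGauge ρ) {S : Set (EuclideanSpace ℝ (Fin N))} (hS : IsOpenConvexCone S)
    (hK0 : volume (S ∩ {y | ρ y < 1}) ≠ 0) {f : EuclideanSpace ℝ (Fin N) → ℝ}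
    {M : ℝ} (hM : HasVariationLE ρ S f M) (hf : Integrable f) (hfc : HasCompactSupport f)
    (hf0 : ∀ x, 0 ≤ f x) (s : ℝ) {a : EuclideanSpace ℝ (Fin N)} (ha : a ∈ S) :
    ENNReal.ofReal (N * s) * volume (S ∩ {y | ρ y < 1}) ^ (1 / N : ℝ) *
      volume (S ∩ {x | s < f (x + a)}) ^ (((N : ℝ) - 1) / N) ≤ ENNReal.ofReal M := by
  have hN' : (2 : ℝ) ≤ N := by exact_mod_cast hN
  have hKt : volume (S ∩ {y | ρ y < 1}) ≠ ⊤ :=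
    ((hρ.isBounded_ball 1).subset inter_subset_right).measure_lt_top.ne
  obtain ⟨r, hr, hrS⟩ := Metric.isOpen_iff.1 hS.1 a ha
  let φ : ℕ → ContDiffBump (0 : EuclideanSpace ℝ (Fin N)) := fun n =>
    ⟨r / (n + 1) / 2, r / (n + 1), by positivity, half_lt_self (by positivity)⟩
  have hφr : ∀ n, (φ n).rOut ≤ r := fun n =>
    div_le_self hr.le (by linarith [n.cast_nonneg (α := ℝ)])
  have hlim : Filter.Tendsto (fun n => (φ n).rOut) Filter.atTop (𝓝 0) := by
    have h := (tendsto_one_div_add_atTop_nhds_zero_nat (𝕜 := ℝ)).const_mul r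
    rw [mul_zero] at h
    exact h.congr fun n => by simp [φ, div_eq_mul_inv]
  have hae := ContDiffBump.ae_convolution_tendsto_right_of_locallyIntegrable (μ := volume) hlim
    (K := 2) (Filter.Eventually.of_forall fun n => by simp only [φ]; linarith)
    hf.locallyIntegrable
  have hae' := (measurePreserving_add_right volume a).quasiMeasurePreserving.ae hae
  set w : ℕ → EuclideanSpace ℝ (Fin N) → ℝ := fun n x =>
    convolution ((φ n).normed volume) f (ContinuousLinearMap.lsmul ℝ ℝ) volume (x + a) with hw
  refine mul_measure_rpow_le_of_eventually_mem (B := fun n => S ∩ {x | s < w n x})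
    (b := fun _ => ENNReal.ofReal M) ?_ ?_ ?_ tendsto_const_nhds fun n => ?_
  · filter_upwards [hae'] with x hx hxA
    filter_upwards [hx.eventually (lt_mem_nhds hxA.2)] with n hn
    exact ⟨hxA.1, hn⟩
  · exact ENNReal.mul_ne_top ENNReal.ofReal_ne_top
      (ENNReal.rpow_ne_top_of_nonneg (by positivity) hKt)
  · exact div_nonneg (by linarith) (by linarith)
  · refine (hM.convolution_comp_add hS hf
      ((ball_subset_ball (hφr n)).trans hrS)).mul_volume_superlevel_le hN hρ hS hK0 ?_ ?_ ?_ s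
    · have h := (φ n).hasCompactSupport_normed (μ := volume) |>.contDiff_convolution_left (n := 2)
        (ContinuousLinearMap.lsmul ℝ ℝ) (φ n).contDiff_normed hf.locallyIntegrable
      exact h.comp (contDiff_id.add contDiff_const)
    · exact (((φ n).hasCompactSupport_normed (μ := volume)).convolution
        (ContinuousLinearMap.lsmul ℝ ℝ) hfc).comp_homeomorph (Homeomorph.addRight a)
    · intro x
      rw [convolution_def]
      exact integral_nonneg fun z => mul_nonneg ((φ n).nonneg_normed z) (hf0 _)

theorem HasVariationLE.mul_volume_superlevel_le_of_integrable {N : ℕ} (hN : 2 ≤ N)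
    {ρ : EuclideanSpace ℝ (Fin N) → ℝ}
    (hρ : IsGauge ρ) {S : Set (EuclideanSpace ℝ (Fin N))} (hS : IsOpenConvexCone S)
    (hK0 : volume (S ∩ {y | ρ y < 1}) ≠ 0) {f : EuclideanSpace ℝ (Fin N) → ℝ}
    {M : ℝ} (hM : HasVariationLE ρ S f M) (hf : Integrable f) (hfc : HasCompactSupport f)
    (hf0 : ∀ x, 0 ≤ f x) (s : ℝ) :
    ENNReal.ofReal (N * s) * volume (S ∩ {y | ρ y < 1}) ^ (1 / N : ℝ) *
      volume (S ∩ {x | s < f x}) ^ (((N : ℝ) - 1) / N) ≤ ENNReal.ofReal M := by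
  have hN' : (2 : ℝ) ≤ N := by exact_mod_cast hN
  have hKt : volume (S ∩ {y | ρ y < 1}) ≠ ⊤ :=
    ((hρ.isBounded_ball 1).subset inter_subset_right).measure_lt_top.ne
  obtain ⟨e, he, -⟩ := nonempty_of_measure_ne_zero hK0
  set a : ℕ → EuclideanSpace ℝ (Fin N) := fun n => (1 / ((n : ℝ) + 1)) • e with ha
  have haS : ∀ n, a n ∈ S := fun n => hS.2.2 e he _ (by positivity)
  have ha0 : Filter.Tendsto a Filter.atTop (𝓝 0) := by
    have h := (tendsto_one_div_add_atTop_nhds_zero_nat (𝕜 := ℝ)).smul_const e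
    rwa [zero_smul] at h
  refine mul_measure_rpow_le_of_eventually_mem
    (B := fun n => {x | x - a n ∈ S} ∩ {x | s < f x})
    (b := fun _ => ENNReal.ofReal M) ?_ ?_ ?_ tendsto_const_nhds fun n => ?_
  · refine Filter.Eventually.of_forall fun x hx => ?_
    have h : Filter.Tendsto (fun n => x - a n) Filter.atTop (𝓝 x) := by
      simpa using ha0.const_sub x
    filter_upwards [h.eventually (hS.1.mem_nhds hx.1)] with n hn
    exact ⟨hn, hx.2⟩
  · exact ENNReal.mul_ne_top ENNReal.ofReal_ne_top
      (ENNReal.rpow_ne_top_of_nonneg (by positivity) hKt)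
  · exact div_nonneg (by linarith) (by linarith)
  · have h := hM.mul_volume_translate_superlevel_le hN hρ hS hK0 hf hfc hf0 s (haS n)
    have e1 : (· + a n) ⁻¹' ({x | x - a n ∈ S} ∩ {x | s < f x}) = S ∩ {x | s < f (x + a n)} := by
      ext x
      simp
    rwa [← e1, measure_preimage_add_right] at h

theorem HasVariationLE.mul_volume_rpow_le {N : ℕ} (hN : 2 ≤ N)
    {ρ : EuclideanSpace ℝ (Fin N) → ℝ}
    (hρ : IsGauge ρ) {S : Set (EuclideanSpace ℝ (Fin N))} (hS : IsOpenConvexCone S)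
    (hK0 : volume (S ∩ {y | ρ y < 1}) ≠ 0) {E : Set (EuclideanSpace ℝ (Fin N))}
    (hE : MeasurableSet E) (hEfin : volume (S ∩ E) ≠ ⊤) {M : ℝ}
    (hM : HasVariationLE ρ S (E.indicator 1) M) :
    ENNReal.ofReal N * volume (S ∩ {y | ρ y < 1}) ^ (1 / N : ℝ) *
      volume (S ∩ E) ^ (((N : ℝ) - 1) / N) ≤ ENNReal.ofReal M := by
  have hN' : (2 : ℝ) ≤ N := by exact_mod_cast hN
  have hKt : volume (S ∩ {y | ρ y < 1}) ≠ ⊤ :=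
    ((hρ.isBounded_ball 1).subset inter_subset_right).measure_lt_top.ne
  have hp : 0 ≤ ((N : ℝ) - 1) / N := div_nonneg (by linarith) (by linarith)
  have hK' : volume (S ∩ {y | ρ y < 1}) ^ (1 / N : ℝ) ≠ ⊤ :=
    ENNReal.rpow_ne_top_of_nonneg (by positivity) hKt
  have hm : MeasurableSet (S ∩ E) := hS.1.measurableSet.inter hE
  obtain ⟨c, hc, hcρ⟩ := hρ.lower
  obtain ⟨χ, C, hχ⟩ := exists_cutoff_sequence (N := N)
  have step : ∀ s : ℝ, s < 1 →
      ENNReal.ofReal (N * s) * volume (S ∩ {y | ρ y < 1}) ^ (1 / N : ℝ) *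
        volume (S ∩ E) ^ (((N : ℝ) - 1) / N) ≤ ENNReal.ofReal M := by
    intro s hs
    refine mul_measure_rpow_le_of_eventually_mem
      (B := fun n => S ∩ {x | s < (S ∩ E).indicator (χ n) x})
      (b := fun n => ENNReal.ofReal (M + C / (n + 1) * c⁻¹ * (volume (S ∩ E)).toReal))
      ?_ ?_ hp ?_ fun n => ?_
    · refine Filter.Eventually.of_forall fun x hx => ?_
      filter_upwards [Filter.eventually_ge_atTop ⌈‖x‖⌉₊] with n hn
      refine ⟨hx.1, ?_⟩
      have h1 : ‖x‖ ≤ n + 1 := by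
        have : (⌈‖x‖⌉₊ : ℝ) ≤ n := by exact_mod_cast hn
        linarith [Nat.le_ceil ‖x‖]
      rw [mem_ofPred_eq, indicator_of_mem hx, (hχ n).2.2.2.2.1 x h1]
      exact hs
    · exact ENNReal.mul_ne_top ENNReal.ofReal_ne_top hK'
    · refine ENNReal.tendsto_ofReal ?_
      have h := (((tendsto_one_div_add_atTop_nhds_zero_nat (𝕜 := ℝ)).const_mul C).mul_const
        (c⁻¹ * (volume (S ∩ E)).toReal)).const_add M
      rw [mul_zero, zero_mul, add_zero] at h
      exact h.congr fun n => by ring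
    · obtain ⟨h1, h2, h3, h4, -, h6⟩ := hχ n
      refine (hM.indicator_cutoff hρ hS.1 hE hEfin hc hcρ h1 h3 h4
        h6).mul_volume_superlevel_le_of_integrable hN hρ hS hK0 ?_ ?_ ?_ s
      · exact (h1.continuous.integrable_of_hasCompactSupport h2).indicator hm
      · exact h2.mono (support_indicator.subset.trans inter_subset_right)
      · exact fun x => indicator_nonneg (fun x _ => h3 x) x
  have lim : Filter.Tendsto (fun s : ℝ => ENNReal.ofReal (N * s) *
      volume (S ∩ {y | ρ y < 1}) ^ (1 / N : ℝ) * volume (S ∩ E) ^ (((N : ℝ) - 1) / N)) (𝓝[<] 1)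
      (𝓝 (ENNReal.ofReal (N * 1) *
      volume (S ∩ {y | ρ y < 1}) ^ (1 / N : ℝ) * volume (S ∩ E) ^ (((N : ℝ) - 1) / N))) := by
    refine Filter.Tendsto.mono_left ?_ nhdsWithin_le_nhds
    refine ENNReal.Tendsto.mul_const (ENNReal.Tendsto.mul_const ?_ (Or.inr hK'))
      (Or.inr (ENNReal.rpow_ne_top_of_nonneg hp hEfin))
    exact (ENNReal.continuous_ofReal.comp (continuous_const.mul continuous_id)).tendsto 1
  rw [mul_one] at lim
  refine le_of_tendsto lim ?_
  filter_upwards [self_mem_nhdsWithin] with s hs using step s hs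

theorem ofReal_setIntegral_vdiv_le_periW {N : ℕ} {ρ : EuclideanSpace ℝ (Fin N) → ℝ}
    {S : Set (EuclideanSpace ℝ (Fin N))} (E : Set (EuclideanSpace ℝ (Fin N)))
    {σ : EuclideanSpace ℝ (Fin N) → EuclideanSpace ℝ (Fin N)} (hσ : IsAdmissible ρ S σ) :
    ENNReal.ofReal (∫ x in E, vdiv σ x) ≤ periW ρ (fun _ => (1 : ℝ)) E S := by
  refine le_iSup₂_of_le (f := fun σ _ => ENNReal.ofReal (∫ x in E, vdiv σ x)) σ ?_ le_rfl
  exact ⟨hσ.contDiff, hσ.hasCompactSupport, hσ.tsupport_subset, hσ.le_one⟩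

theorem hasVariationLE_indicator_of_periW_ne_top {N : ℕ} {ρ : EuclideanSpace ℝ (Fin N) → ℝ}
    {S E : Set (EuclideanSpace ℝ (Fin N))} (hE : MeasurableSet E)
    (hP : periW ρ (fun _ => (1 : ℝ)) E S ≠ ⊤) :
    HasVariationLE ρ S (E.indicator 1) (periW ρ (fun _ => (1 : ℝ)) E S).toReal := by
  intro σ hσ
  have e : ∫ x, E.indicator 1 x * vdiv σ x = ∫ x in E, vdiv σ x := by
    rw [← integral_indicator hE]
    refine integral_congr_ae (Filter.Eventually.of_forall fun x => ?_)
    by_cases hx : x ∈ E <;> simp [hx]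
  rw [e]
  exact (ENNReal.ofReal_le_iff_le_toReal hP).1 (ofReal_setIntegral_vdiv_le_periW E hσ)

/-- the anisotropic isoperimetric inequality in convex cones
(Theorem 4.2 of the paper, unweighted case). -/
theorem anisotropic_isoperimetric_inequality_in_cones
    {N : ℕ} (hN : 2 ≤ N)
    (H : EuclideanSpace ℝ (Fin N) → ℝ)
    (hH : IsAnisoNorm H) (hHell : UniformlyElliptic H)
    (S : Set (EuclideanSpace ℝ (Fin N))) (hS : IsOpenConvexCone S)
    (E : Set (EuclideanSpace ℝ (Fin N))) (hE : MeasurableSet E)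
    (hEfin : volume (S ∩ E) < ⊤) :
    periW (dualNorm H) (fun _ => (1:ℝ)) E S *
        volume (S ∩ {y | dualNorm H y < 1}) ^ (((N : ℝ) - 1) / N) ≥
      periW (dualNorm H) (fun _ => (1:ℝ)) {y | dualNorm H y < 1} S *
        volume (S ∩ E) ^ (((N : ℝ) - 1) / N) := by
  have hρ : IsGauge (dualNorm H) := hH.isGauge_dualNorm (by omega) hHell.1.continuousOn
  set ρ := dualNorm H
  have hN' : (2 : ℝ) ≤ N := by exact_mod_cast hN
  have hp : 0 < ((N : ℝ) - 1) / N := div_pos (by linarith) (by linarith)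
  rw [ge_iff_le]
  rcases S.eq_empty_or_nonempty with rfl | ⟨e, he⟩
  · simp [ENNReal.zero_rpow_of_pos hp]
  set K := S ∩ {y | ρ y < 1} with hK
  have hKo : IsOpen K := hS.1.inter (hρ.isOpen_ball 1)
  have hKne : K.Nonempty := by
    have ht : 0 < (ρ e + 1)⁻¹ := inv_pos.2 (by linarith [hρ.nonneg e])
    refine ⟨(ρ e + 1)⁻¹ • e, hS.2.2 e he _ ht, ?_⟩
    rw [mem_ofPred_eq, hρ.smul_eq _ ht.le, inv_mul_lt_iff₀ (inv_pos.1 ht)]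
    linarith
  have hK0 : volume K ≠ 0 := (hKo.measure_pos volume hKne).ne'
  have hKt : volume K ≠ ⊤ := ((hρ.isBounded_ball 1).subset inter_subset_right).measure_lt_top.ne
  have hKp : volume K ^ (((N : ℝ) - 1) / N) ≠ 0 := by
    simp [ENNReal.rpow_eq_zero_iff, hK0, hKt]
  by_cases hP : periW ρ (fun _ => (1 : ℝ)) E S = ⊤
  · rw [hP, ENNReal.top_mul hKp]
    exact le_top
  have hB : periW ρ (fun _ => (1 : ℝ)) {y | ρ y < 1} S ≤ ENNReal.ofReal N * volume K := by
    refine iSup₂_le fun σ hσ => ?_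
    rw [← ENNReal.ofReal_toReal hKt, ← ENNReal.ofReal_mul (by positivity)]
    exact ENNReal.ofReal_le_ofReal
      (setIntegral_vdiv_ball_le hρ hS hσ.1 hσ.2.1 hσ.2.2.1 hσ.2.2.2)
  have hI := (hasVariationLE_indicator_of_periW_ne_top hE hP).mul_volume_rpow_le hN hρ hS hK0 hE
    hEfin.ne
  rw [ENNReal.ofReal_toReal hP] at hI
  have hsplit : volume K = volume K ^ (1 / N : ℝ) * volume K ^ (((N : ℝ) - 1) / N) := by
    rw [← ENNReal.rpow_add _ _ hK0 hKt, ← add_div, add_sub_cancel, div_self (by linarith),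
      ENNReal.rpow_one]
  calc periW ρ (fun _ => (1 : ℝ)) {y | ρ y < 1} S * volume (S ∩ E) ^ (((N : ℝ) - 1) / N)
      ≤ ENNReal.ofReal N * volume K * volume (S ∩ E) ^ (((N : ℝ) - 1) / N) := by gcongr
    _ = ENNReal.ofReal N * volume K ^ (1 / N : ℝ) * volume (S ∩ E) ^ (((N : ℝ) - 1) / N) *
          volume K ^ (((N : ℝ) - 1) / N) := by
        conv_lhs => rw [hsplit]
        ring
    _ ≤ _ := by gcongr
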